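/- arXiv:2210.07067 — 3 statements merged into one kernel-verified Lean document; each statement's English description precedes it below -/
import Mathlib

section
/- Let X be a Banach space, 1 ≤ p ≤ ∞ with conjugate exponent p', and let 0 < q < p'. Let ρ = (ρ_j)_{j≥1} be a sequence with ρ_min := inf_j ρ_j > 1 and (ρ_j^{-1})_{j≥1} ∈ ℓ_q(ℕ). Let (t_ν)_{ν∈F} ⊂ X with M := ‖(ρ^ν ‖t_ν‖_X)_{ν∈F}‖_{ℓ_p(F)} < ∞, and suppose u(y) = Σ_{ν∈F} t_ν y^ν converges absolutely in X for every y ∈ Y. Then for every integer m ≥ 0 there exists a lower set Λ ⊆ F with #Λ = m+1 such that P(y) := Σ_{ν∈Λ} t_ν y^ν satisfies sup_{y∈Y} ‖u(y) − P(y)‖_X ≤ C(ρ,q) · M · ‖(ρ_j^{-1})_{j≥1}‖_{ℓ_q(ℕ)} · (m+1)^{−r}, where r := −1 + 1/p + 1/q, C(ρ,q) := β^{1/q} exp((β/q) ‖(ρ_j^{-1})_{j≥1}‖_{ℓ_q}^q) and β := −ln(1 − ρ_min^{−q}) · ρ_min^{q}. -/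
open scoped BigOperators ENNReal

noncomputable section

/-- The set `F` of finitely supported multi-indices. -/
abbrev MIdx : Type := ℕ →₀ ℕ

/-- `ρ^ν := ∏_j ρ_j^{ν_j}` for a finitely supported multi-index `ν`. -/
def mpow (ρ : ℕ → ℝ) (ν : MIdx) : ℝ := ν.prod fun j k => ρ j ^ k

/-- The `ℓ_p(F)` norm (`p ∈ [1,∞]`, valued in `ℝ≥0∞`) of a family of nonnegative reals. -/
def lpF (p : ℝ≥0∞) (a : MIdx → ℝ) : ℝ≥0∞ :=
  if p = ∞ then ⨆ ν, ENNReal.ofReal (a ν)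
  else (∑' ν, ENNReal.ofReal (a ν) ^ p.toReal) ^ (1 / p.toReal)

open Finset in
/-- A finite sum of monomials over multi-indices is bounded by the product of geometric series. -/
lemma sum_mpow_le_prod {x : ℕ → ℝ} (hx0 : ∀ j, 0 ≤ x j) (hx1 : ∀ j, x j < 1)
    (s : Finset MIdx) :
    ∃ J : Finset ℕ, ∑ ν ∈ s, mpow x ν ≤ ∏ j ∈ J, (1 - x j)⁻¹ := by
  classical
  set J : Finset ℕ := s.biUnion fun ν => ν.support
  set K : ℕ → Finset ℕ := fun j => range (s.sup (fun ν => ν j) + 1)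
  have hmem : s ⊆ J.finsupp K := by
    intro ν hν
    rw [mem_finsupp_iff]
    refine ⟨subset_biUnion_of_mem (fun ν : MIdx => ν.support) hν, fun j _ => ?_⟩
    rw [mem_range, Nat.lt_succ_iff]
    exact le_sup (f := fun ν : MIdx => ν j) hν
  have hnonneg : ∀ ν : MIdx, 0 ≤ mpow x ν := fun ν => prod_nonneg fun j _ => pow_nonneg (hx0 j) _
  refine ⟨J, (sum_le_sum_of_subset_of_nonneg hmem fun ν _ _ => hnonneg ν).trans ?_⟩
  have heq : ∑ ν ∈ J.finsupp K, mpow x ν = ∏ j ∈ J, ∑ k ∈ K j, x j ^ k := by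
    rw [prod_sum, Finset.finsupp, sum_map]
    refine sum_congr (by congr!) fun f _ => ?_
    rw [mpow]
    exact Finsupp.prod_indicator_index_eq_prod_attach f fun _ _ => pow_zero _
  rw [heq]
  refine prod_le_prod (fun j _ => sum_nonneg fun k _ => pow_nonneg (hx0 j) k) fun j _ => ?_
  rw [← tsum_geometric_of_lt_one (hx0 j) (hx1 j)]
  exact (summable_geometric_of_lt_one (hx0 j) (hx1 j)).sum_le_tsum _
    fun k _ => pow_nonneg (hx0 j) k

lemma neg_log_one_sub_le {x x₀ : ℝ} (hx : 0 ≤ x) (hx₀ : 0 < x₀) (hxx₀ : x ≤ x₀) (h1 : x₀ < 1) :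
    -Real.log (1 - x) ≤ -Real.log (1 - x₀) * x₀⁻¹ * x := by
  have h := strictConcaveOn_log_Ioi.concaveOn.2
    (Set.mem_Ioi.2 (one_pos (α := ℝ))) (Set.mem_Ioi.2 (by linarith : (0 : ℝ) < 1 - x₀))
    (by rw [sub_nonneg, div_le_one hx₀]; exact hxx₀ : 0 ≤ 1 - x / x₀)
    (by positivity : 0 ≤ x / x₀) (by ring)
  have e : (1 - x / x₀) • (1 : ℝ) + (x / x₀) • (1 - x₀) = 1 - x := by
    simp only [smul_eq_mul]; field_simp; ring
  rw [e] at h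
  simp only [smul_eq_mul, Real.log_one, mul_zero, zero_add] at h
  have e2 : -Real.log (1 - x₀) * x₀⁻¹ * x = -(x / x₀ * Real.log (1 - x₀)) := by
    field_simp
  rw [e2]
  linarith

/-- Finite sums of monomials over multi-indices are bounded by an exponential. -/
lemma sum_mpow_le_exp {x : ℕ → ℝ} {x₀ : ℝ} (hx : ∀ j, 0 ≤ x j) (hx₀ : 0 < x₀)
    (hxx₀ : ∀ j, x j ≤ x₀) (h1 : x₀ < 1) (hs : Summable x) (s : Finset MIdx) :
    ∑ ν ∈ s, mpow x ν ≤ Real.exp (-Real.log (1 - x₀) * x₀⁻¹ * ∑' j, x j) := by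
  obtain ⟨J, hJ⟩ := sum_mpow_le_prod hx (fun j => (hxx₀ j).trans_lt h1) s
  have hβ : 0 ≤ -Real.log (1 - x₀) * x₀⁻¹ :=
    mul_nonneg (neg_nonneg.2 (Real.log_nonpos (by linarith) (by linarith))) (inv_nonneg.2 hx₀.le)
  calc ∑ ν ∈ s, mpow x ν ≤ ∏ j ∈ J, (1 - x j)⁻¹ := hJ
    _ ≤ ∏ j ∈ J, Real.exp (-Real.log (1 - x₀) * x₀⁻¹ * x j) := by
      refine Finset.prod_le_prod (fun j _ => inv_nonneg.2 (by linarith [hxx₀ j])) fun j _ => ?_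
      rw [← Real.exp_log (inv_pos.2 (by linarith [hxx₀ j] : 0 < 1 - x j)), Real.log_inv]
      exact Real.exp_le_exp.2 (neg_log_one_sub_le (hx j) hx₀ (hxx₀ j) h1)
    _ = Real.exp (-Real.log (1 - x₀) * x₀⁻¹ * ∑ j ∈ J, x j) := by
      rw [← Real.exp_sum, Finset.mul_sum]
    _ ≤ _ := Real.exp_le_exp.2 (mul_le_mul_of_nonneg_left (hs.sum_le_tsum J fun j _ => hx j) hβ)

lemma mpow_lt_mpow_of_lt {x : ℕ → ℝ} (hx0 : ∀ j, 0 < x j) (hx1 : ∀ j, x j < 1)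
    {μ ν : MIdx} (h : μ < ν) : mpow x ν < mpow x μ := by
  obtain ⟨hle, j, hj⟩ := Finsupp.lt_def.1 h
  have hμ : mpow x μ = ∏ j ∈ ν.support, x j ^ μ j :=
    Finsupp.prod_of_support_subset _ (Finsupp.support_mono hle) _ fun _ _ => pow_zero _
  rw [hμ]
  refine Finset.prod_lt_prod (fun i _ => pow_pos (hx0 i) _)
    (fun i _ => pow_le_pow_of_le_one (hx0 i).le (hx1 i).le (hle i))
    ⟨j, ?_, pow_lt_pow_right_of_lt_one₀ (hx0 j) (hx1 j) hj⟩
  rw [Finsupp.mem_support_iff]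
  omega

/-- A summable nonnegative family on an infinite type has, for each `n`, a set of `n` indices
carrying the `n` largest values. -/
lemma exists_finset_card_eq_of_summable {ι : Type*} [Infinite ι] {w : ι → ℝ} (hw : Summable w)
    (hpos : ∀ i, 0 < w i) (n : ℕ) :
    ∃ Λ : Finset ι, Λ.card = n ∧ ∀ i ∈ Λ, ∀ k ∉ Λ, w k ≤ w i := by
  classical
  induction n with
  | zero => exact ⟨∅, rfl, by simp⟩
  | succ n ih =>
    obtain ⟨Λ, hcard, hΛ⟩ := ih
    obtain ⟨i₀, hi₀⟩ := Infinite.exists_notMem_finset Λ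
    have hfin : {i | w i₀ ≤ w i}.Finite := by
      have := hw.tendsto_cofinite_zero.eventually_lt_const (hpos i₀)
      simpa [Filter.eventually_cofinite, not_lt] using this
    obtain ⟨k, hk, hmax⟩ := (hfin.subset (Set.inter_subset_left (t := {i | i ∉ Λ}))).exists_maximalFor
      w _ ⟨i₀, le_refl (w i₀), hi₀⟩
    have hkmax : ∀ i ∉ Λ, w i ≤ w k := by
      intro i hi
      rcases le_total (w i₀) (w i) with h | h
      · rcases le_total (w i) (w k) with h' | h'
        · exact h'
        · exact hmax ⟨h, hi⟩ h'
      · exact h.trans hk.1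
    refine ⟨insert k Λ, by rw [Finset.card_insert_of_notMem hk.2, hcard], ?_⟩
    intro i hi l hl
    rw [Finset.mem_insert, not_or] at hl
    rcases Finset.mem_insert.1 hi with rfl | hi
    · exact hkmax l hl.2
    · exact hΛ i hi l hl.2

/-- Hölder's inequality on finite sums against the `lpF` norm, with the conjugate weight written
as a power `1 - 1 / p`. -/
lemma sum_mul_rpow_le_lpF {p : ℝ≥0∞} (hp : 1 ≤ p) {a w : MIdx → ℝ} (ha : ∀ ν, 0 ≤ a ν)
    (hw : ∀ ν, 0 ≤ w ν) (hfin : lpF p a ≠ ∞) (s : Finset MIdx) :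
    ∑ ν ∈ s, a ν * w ν ^ (1 - 1 / p.toReal) ≤
      (lpF p a).toReal * (∑ ν ∈ s, w ν) ^ (1 - 1 / p.toReal) := by
  by_cases hp' : p = ∞
  · subst hp'
    simp only [ENNReal.toReal_top, div_zero, sub_zero, Real.rpow_one]
    rw [Finset.mul_sum]
    refine Finset.sum_le_sum fun ν _ => mul_le_mul_of_nonneg_right ?_ (hw ν)
    refine (ENNReal.ofReal_le_iff_le_toReal hfin).1 ?_
    rw [lpF, if_pos rfl]
    exact le_iSup (fun ν => ENNReal.ofReal (a ν)) ν
  have h1 : 1 ≤ p.toReal := by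
    simpa using ENNReal.toReal_mono hp' hp
  have h0 : 0 < p.toReal := one_pos.trans_le h1
  have hM : (∑ ν ∈ s, a ν ^ p.toReal) ^ (1 / p.toReal) ≤ (lpF p a).toReal := by
    refine (ENNReal.ofReal_le_iff_le_toReal hfin).1 ?_
    rw [lpF, if_neg hp', ← ENNReal.ofReal_rpow_of_nonneg
      (Finset.sum_nonneg fun ν _ => Real.rpow_nonneg (ha ν) _) (by positivity),
      ENNReal.ofReal_sum_of_nonneg fun ν _ => Real.rpow_nonneg (ha ν) _]
    refine ENNReal.rpow_le_rpow ?_ (by positivity)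
    simp_rw [← ENNReal.ofReal_rpow_of_nonneg (ha _) h0.le]
    exact ENNReal.sum_le_tsum s
  have hW : 0 ≤ ∑ ν ∈ s, w ν := Finset.sum_nonneg fun ν _ => hw ν
  refine le_trans ?_ (mul_le_mul_of_nonneg_right hM (Real.rpow_nonneg hW _))
  rcases h1.eq_or_lt with h | h
  · simp [← h]
  have hc := Real.HolderConjugate.conjExponent h
  have he : 1 - 1 / p.toReal = 1 / p.toReal.conjExponent := by
    have := hc.inv_add_inv_eq_one
    rw [one_div, one_div]; linarith
  rw [he]
  refine (Real.inner_le_Lp_mul_Lq_of_nonneg s hc (fun ν _ => ha ν)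
    (fun ν _ => Real.rpow_nonneg (hw ν) _)).trans_eq ?_
  congr 2
  refine Finset.sum_congr rfl fun ν _ => ?_
  rw [← Real.rpow_mul (hw ν), one_div_mul_cancel hc.symm.ne_zero, Real.rpow_one]

lemma abs_mpow_le_one {y : ℕ → ℝ} (hy : ∀ j, |y j| ≤ 1) (ν : MIdx) : |mpow y ν| ≤ 1 := by
  rw [mpow, Finsupp.prod, Finset.abs_prod]
  refine Finset.prod_le_one (fun j _ => abs_nonneg _) fun j _ => ?_
  rw [abs_pow]
  exact pow_le_one₀ (abs_nonneg _) (hy j)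

lemma mpow_inv_rpow {ρ : ℕ → ℝ} (hρ : ∀ j, 0 < ρ j) (q : ℝ) (ν : MIdx) :
    mpow (fun j => ((ρ j)⁻¹) ^ q) ν = ((mpow ρ ν)⁻¹) ^ q := by
  simp only [mpow, Finsupp.prod]
  rw [← Finset.prod_inv_distrib, ← Real.finsetProd_rpow _ _ fun j _ =>
    inv_nonneg.2 (pow_nonneg (hρ j).le _)]
  refine Finset.prod_congr rfl fun j _ => ?_
  rw [← inv_pow, Real.rpow_pow_comm (inv_nonneg.2 (hρ j).le)]

/-- A bound on all finite partial sums of norms off `Λ` bounds the truncation error. -/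
lemma norm_tsum_sub_sum_le {ι E : Type*} [NormedAddCommGroup E] {f : ι → E} (hf : Summable f)
    (Λ : Finset ι) {B : ℝ} (hB : ∀ s : Finset ι, Disjoint s Λ → ∑ i ∈ s, ‖f i‖ ≤ B) :
    ‖(∑' i, f i) - ∑ i ∈ Λ, f i‖ ≤ B := by
  classical
  have ht : Filter.Tendsto (fun s : Finset ι => ‖∑ i ∈ s, f i - ∑ i ∈ Λ, f i‖) Filter.atTop
      (nhds ‖(∑' i, f i) - ∑ i ∈ Λ, f i‖) := (Filter.Tendsto.sub_const hf.hasSum _).norm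
  refine le_of_tendsto ht ?_
  filter_upwards [Filter.eventually_ge_atTop Λ] with s hs
  rw [← Finset.sum_sdiff hs, add_sub_cancel_right]
  exact (norm_sum_le _ _).trans (hB _ Finset.sdiff_disjoint)

/-- Global Taylor approximation error estimate with the explicit constant
`C(ρ,q) = β^{1/q} exp((β/q)‖(ρ_j^{-1})‖_{ℓ_q}^q)`, `β = -ln(1 - ρ_min^{-q}) ρ_min^q`:
there is a lower set `Λ` of cardinality `m+1` with
`sup_{y∈Y}‖u(y) − P(y)‖ ≤ C(ρ,q) M ‖(ρ_j^{-1})‖_{ℓ_q(ℕ)} (m+1)^{-r}`.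
(The condition `0 < q < p'` is encoded by `0 < q` together with `0 < r`.) -/
theorem global_taylor_error_explicit_constant
    {X : Type*} [NormedAddCommGroup X] [NormedSpace ℝ X] [CompleteSpace X]
    (p : ℝ≥0∞) (hp : 1 ≤ p)
    (q : ℝ) (hq : 0 < q)
    (r : ℝ) (hrdef : r = -1 + 1 / p.toReal + 1 / q) (hr : 0 < r)
    (ρ : ℕ → ℝ) (ρmin : ℝ) (hρmin : ρmin = ⨅ j, ρ j) (hmin : 1 < ρmin)
    (hρq : Summable fun j => ((ρ j)⁻¹) ^ q)
    (β : ℝ) (hβ : β = -Real.log (1 - ρmin ^ (-q)) * ρmin ^ q)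
    (C : ℝ) (hC : C = β ^ (1 / q) * Real.exp (β / q * ∑' j, ((ρ j)⁻¹) ^ q))
    (t : MIdx → X)
    (hMfin : lpF p (fun ν => mpow ρ ν * ‖t ν‖) ≠ ∞)
    (habs : ∀ y : ℕ → ℝ, (∀ j, |y j| ≤ 1) →
      Summable fun ν : MIdx => ‖mpow y ν • t ν‖)
    (m : ℕ) :
    ∃ Λ : Finset MIdx, Λ.card = m + 1 ∧
      (∀ ν ∈ Λ, ∀ μ : MIdx, μ ≤ ν → μ ∈ Λ) ∧
      ∀ y : ℕ → ℝ, (∀ j, |y j| ≤ 1) →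
        ‖(∑' ν : MIdx, mpow y ν • t ν) - ∑ ν ∈ Λ, mpow y ν • t ν‖ ≤
          C * (lpF p fun ν => mpow ρ ν * ‖t ν‖).toReal *
            (∑' j, ((ρ j)⁻¹) ^ q) ^ (1 / q) * ((m : ℝ) + 1) ^ (-r) := by
  classical
  have hbdd : BddBelow (Set.range ρ) := by
    by_contra h
    rw [hρmin, iInf, Real.sInf_of_not_bddBelow h] at hmin
    linarith
  have hρle : ∀ j, ρmin ≤ ρ j := fun j => hρmin ▸ ciInf_le hbdd j
  have hmin0 : 0 < ρmin := one_pos.trans hmin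
  have hρ0 : ∀ j, 0 < ρ j := fun j => hmin0.trans_le (hρle j)
  set x : ℕ → ℝ := fun j => ((ρ j)⁻¹) ^ q with hxdef
  set S : ℝ := ∑' j, x j with hS
  set x₀ : ℝ := ρmin ^ (-q) with hx₀def
  have hx₀ : 0 < x₀ := Real.rpow_pos_of_pos hmin0 _
  have hx₀1 : x₀ < 1 := Real.rpow_lt_one_of_one_lt_of_neg hmin (by linarith)
  have hx : ∀ j, 0 < x j := fun j => Real.rpow_pos_of_pos (inv_pos.2 (hρ0 j)) _
  have hxx₀ : ∀ j, x j ≤ x₀ := by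
    intro j
    rw [hx₀def, Real.rpow_neg hmin0.le, ← Real.inv_rpow hmin0.le]
    exact Real.rpow_le_rpow (inv_nonneg.2 (hρ0 j).le) (inv_anti₀ hmin0 (hρle j)) hq.le
  have hβ' : β = -Real.log (1 - x₀) * x₀⁻¹ := by
    rw [hβ, hx₀def, Real.rpow_neg hmin0.le, inv_inv]
  have hβ0 : 0 ≤ β := by
    rw [hβ']
    exact mul_nonneg (neg_nonneg.2 (Real.log_nonpos (by linarith) (by linarith)))
      (inv_nonneg.2 hx₀.le)
  have hS0 : 0 ≤ S := tsum_nonneg fun j => (hx j).le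
  have hsum : ∀ s : Finset MIdx, ∑ ν ∈ s, mpow x ν ≤ Real.exp (β * S) := fun s =>
    hβ' ▸ sum_mpow_le_exp (fun j => (hx j).le) hx₀ hxx₀ hx₀1 hρq s
  have hw : ∀ ν, 0 < mpow x ν := fun ν => Finset.prod_pos fun j _ => pow_pos (hx j) _
  set T : ℝ := Real.exp (β * S) - 1 with hT
  have hT0 : 0 ≤ T := by
    have := Real.add_one_le_exp (β * S)
    have := mul_nonneg hβ0 hS0
    linarith
  have hsumT : ∀ s : Finset MIdx, 0 ∉ s → ∑ ν ∈ s, mpow x ν ≤ T := by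
    intro s hs
    have h := hsum (insert 0 s)
    rw [Finset.sum_insert hs] at h
    have h0 : mpow x 0 = 1 := Finsupp.prod_zero_index
    linarith
  have hwsum : Summable (mpow x) := summable_of_sum_le (fun ν => (hw ν).le) hsum
  obtain ⟨Λ, hcard, hΛ⟩ := exists_finset_card_eq_of_summable hwsum hw (m + 1)
  have hlower : ∀ ν ∈ Λ, ∀ μ : MIdx, μ ≤ ν → μ ∈ Λ := by
    intro ν hν μ hμ
    by_contra hμΛ
    have hlt : μ < ν := lt_of_le_of_ne hμ fun h => hμΛ (h ▸ hν)
    exact (hΛ ν hν μ hμΛ).not_gt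
      (mpow_lt_mpow_of_lt hx (fun j => (hxx₀ j).trans_lt hx₀1) hlt)
  have h0Λ : (0 : MIdx) ∈ Λ := by
    obtain ⟨ν, hν⟩ := Finset.card_pos.1 (by omega : 0 < Λ.card)
    exact hlower ν hν 0 zero_le
  have hm : (0 : ℝ) < (m : ℝ) + 1 := by positivity
  have htail : ∀ ν ∉ Λ, mpow x ν ≤ T / ((m : ℝ) + 1) := by
    intro ν hν
    have hν' : ν ∉ Λ.erase 0 := fun h => hν (Finset.mem_of_mem_erase h)
    have hc : (insert ν (Λ.erase 0)).card = m + 1 := by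
      rw [Finset.card_insert_of_notMem hν', Finset.card_erase_of_mem h0Λ, hcard]; rfl
    have h0 : (0 : MIdx) ∉ insert ν (Λ.erase 0) := by
      rw [Finset.mem_insert, not_or]
      exact ⟨fun h => hν (h ▸ h0Λ), Finset.notMem_erase 0 Λ⟩
    have h := (Finset.card_nsmul_le_sum (insert ν (Λ.erase 0)) (mpow x) (mpow x ν) (by
      intro μ hμ
      rcases Finset.mem_insert.1 hμ with rfl | hμ
      · exact le_rfl
      · exact hΛ μ (Finset.mem_of_mem_erase hμ) ν hν)).trans (hsumT _ h0)
    rw [hc, nsmul_eq_mul] at h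
    rw [le_div_iff₀ hm, mul_comm]
    exact_mod_cast h
  set M : ℝ := (lpF p fun ν => mpow ρ ν * ‖t ν‖).toReal with hM
  have hM0 : 0 ≤ M := ENNReal.toReal_nonneg
  have hρν : ∀ ν, 0 < mpow ρ ν := fun ν => Finset.prod_pos fun j _ => pow_pos (hρ0 j) _
  have hθ : 0 ≤ 1 - 1 / p.toReal := by
    by_cases hp' : p = ∞
    · simp [hp']
    have h1 : 1 ≤ p.toReal := by simpa using ENNReal.toReal_mono hp' hp
    rw [sub_nonneg]
    exact (div_le_one (one_pos.trans_le h1)).2 h1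
  have hexp : 1 / q = r + (1 - 1 / p.toReal) := by rw [hrdef]; ring
  have hterm : ∀ ν ∉ Λ, ‖t ν‖ ≤ (T / ((m : ℝ) + 1)) ^ r *
      (mpow ρ ν * ‖t ν‖ * mpow x ν ^ (1 - 1 / p.toReal)) := by
    intro ν hν
    have hinv : (mpow ρ ν)⁻¹ = mpow x ν ^ r * mpow x ν ^ (1 - 1 / p.toReal) := by
      rw [← Real.rpow_add (hw ν), ← hexp, hxdef, mpow_inv_rpow hρ0,
        ← Real.rpow_mul (inv_nonneg.2 (hρν ν).le), mul_one_div_cancel hq.ne', Real.rpow_one]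
    calc ‖t ν‖ = (mpow ρ ν)⁻¹ * (mpow ρ ν * ‖t ν‖) := by
          rw [inv_mul_cancel_left₀ (hρν ν).ne']
      _ = mpow x ν ^ r * (mpow ρ ν * ‖t ν‖ * mpow x ν ^ (1 - 1 / p.toReal)) := by
          rw [hinv]; ring
      _ ≤ _ := by
          refine mul_le_mul_of_nonneg_right
            (Real.rpow_le_rpow (hw ν).le (htail ν hν) hr.le) ?_
          exact mul_nonneg (mul_nonneg (hρν ν).le (norm_nonneg _)) (Real.rpow_nonneg (hw ν).le _)
  have hTle : T ≤ β * S * Real.exp (β * S) := by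
    have h := Real.add_one_le_exp (-(β * S))
    have h2 := mul_le_mul_of_nonneg_right h (Real.exp_pos (β * S)).le
    rw [← Real.exp_add, neg_add_cancel, Real.exp_zero] at h2
    rw [hT]
    linarith
  have hTq : T ^ (1 / q) ≤ C * S ^ (1 / q) := by
    refine (Real.rpow_le_rpow hT0 hTle (by positivity)).trans_eq ?_
    rw [Real.mul_rpow (mul_nonneg hβ0 hS0) (Real.exp_pos _).le, Real.mul_rpow hβ0 hS0,
      ← Real.exp_mul, hC, show β * S * (1 / q) = β / q * S by ring]
    ring
  have hfinal : ∀ s : Finset MIdx, Disjoint s Λ →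
      ∑ ν ∈ s, ‖t ν‖ ≤ C * M * S ^ (1 / q) * ((m : ℝ) + 1) ^ (-r) := by
    intro s hs
    have hsΛ : ∀ ν ∈ s, ν ∉ Λ := fun ν hν => Finset.disjoint_left.1 hs hν
    have hTr : 0 ≤ (T / ((m : ℝ) + 1)) ^ r := Real.rpow_nonneg (div_nonneg hT0 hm.le) _
    calc ∑ ν ∈ s, ‖t ν‖
        ≤ ∑ ν ∈ s, (T / ((m : ℝ) + 1)) ^ r *
            (mpow ρ ν * ‖t ν‖ * mpow x ν ^ (1 - 1 / p.toReal)) :=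
          Finset.sum_le_sum fun ν hν => hterm ν (hsΛ ν hν)
      _ = (T / ((m : ℝ) + 1)) ^ r *
            ∑ ν ∈ s, mpow ρ ν * ‖t ν‖ * mpow x ν ^ (1 - 1 / p.toReal) :=
          (Finset.mul_sum _ _ _).symm
      _ ≤ (T / ((m : ℝ) + 1)) ^ r * (M * T ^ (1 - 1 / p.toReal)) := by
          refine mul_le_mul_of_nonneg_left ?_ hTr
          refine (sum_mul_rpow_le_lpF hp
            (fun ν => mul_nonneg (hρν ν).le (norm_nonneg (t ν))) (fun ν => (hw ν).le)
            hMfin s).trans ?_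
          refine mul_le_mul_of_nonneg_left ?_ hM0
          exact Real.rpow_le_rpow (Finset.sum_nonneg fun ν _ => (hw ν).le)
            (hsumT s fun h => hsΛ 0 h h0Λ) hθ
      _ = T ^ (1 / q) * (M * ((m : ℝ) + 1) ^ (-r)) := by
          rw [hexp, Real.rpow_add_of_nonneg hT0 hr.le hθ, Real.div_rpow hT0 hm.le,
            Real.rpow_neg hm.le]
          ring
      _ ≤ C * S ^ (1 / q) * (M * ((m : ℝ) + 1) ^ (-r)) :=
          mul_le_mul_of_nonneg_right hTq (mul_nonneg hM0 (Real.rpow_nonneg hm.le _))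
      _ = _ := by ring
  refine ⟨Λ, hcard, hlower, fun y hy => ?_⟩
  refine norm_tsum_sub_sum_le (habs y hy).of_norm Λ fun s hs => le_trans ?_ (hfinal s hs)
  refine Finset.sum_le_sum fun ν _ => ?_
  rw [norm_smul, Real.norm_eq_abs]
  exact mul_le_of_le_one_left (norm_nonneg _) (abs_mpow_le_one hy ν)
end
end

section
/- Let X be a Banach space, ρ = (ρ_j)_{j≥1} a sequence with ρ_j > 1 for all j, and y ∈ Y with Σ_{j≥1} |y_j|/ρ_j < ∞. For v = (v_ν)_{ν∈F} define (T_{ρ,y} v)_ν := (ρ − |y|)^ν Σ_{μ≥ν} v_μ · (μ!/((μ−ν)! ν!)) · ρ^{−μ} y^{μ−ν}. Then for every 1 ≤ p ≤ ∞ and every v ∈ ℓ_p(F, X), one has (T_{ρ,y} v) ∈ ℓ_p(F, X) with ‖T_{ρ,y} v‖_{ℓ_p(F,X)} ≤ (∏_{j=1}^∞ (1 − |y_j|/ρ_j)^{−1})^{1 − 1/p} · ‖v‖_{ℓ_p(F,X)}. -/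
open scoped BigOperators ENNReal

noncomputable section

/-- `μ!/((μ-ν)!ν!) = ∏_j C(μ_j, ν_j)` (meaningful for `ν ≤ μ`). -/
def mchoose (μ ν : MIdx) : ℕ := μ.prod fun j k => k.choose (ν j)

section BinomialKernel

/-- The binomial weight `C(m, n) (1 - t)^n t^(m - n)`. -/
def binomKernel (t : ℝ) (n m : ℕ) : ℝ := m.choose n * (1 - t) ^ n * t ^ (m - n)

lemma binomKernel_nonneg {t : ℝ} (h0 : 0 ≤ t) (h1 : t < 1) (n m : ℕ) :
    0 ≤ binomKernel t n m := by
  have : 0 ≤ 1 - t := by linarith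
  unfold binomKernel
  positivity

@[simp] lemma binomKernel_zero_zero (t : ℝ) : binomKernel t 0 0 = 1 := by
  simp [binomKernel]

lemma hasSum_binomKernel_left (t : ℝ) (m : ℕ) : HasSum (fun n => binomKernel t n m) 1 := by
  have h : ∑ n ∈ Finset.range (m + 1), binomKernel t n m = 1 := by
    have := add_pow (1 - t) t m
    rw [sub_add_cancel, one_pow] at this
    rw [this]
    exact Finset.sum_congr rfl fun n _ => by unfold binomKernel; ring
  rw [← h]
  refine hasSum_sum_of_ne_finset_zero fun n hn => ?_
  have : m < n := by simpa using hn
  simp [binomKernel, Nat.choose_eq_zero_of_lt this]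

lemma hasSum_binomKernel_right {t : ℝ} (h0 : 0 ≤ t) (h1 : t < 1) (n : ℕ) :
    HasSum (fun m => binomKernel t n m) (1 - t)⁻¹ := by
  have hne : 1 - t ≠ 0 := by linarith
  have h := (hasSum_choose_mul_geometric_of_norm_lt_one n
    (r := t) (by rwa [Real.norm_of_nonneg h0])).mul_left ((1 - t) ^ n)
  have hval : (1 - t) ^ n * (1 / (1 - t) ^ (n + 1)) = (1 - t)⁻¹ := by
    rw [pow_succ]
    field_simp
  rw [hval] at h
  refine ((add_left_injective n).hasSum_iff fun m hm => ?_).1 (h.congr_fun ?_)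
  · have : m < n := by
      by_contra! hle
      exact hm ⟨m - n, Nat.sub_add_cancel hle⟩
    simp [binomKernel, Nat.choose_eq_zero_of_lt this]
  · intro i
    simp only [Function.comp, binomKernel, Nat.add_sub_cancel]
    ring

lemma tsum_ofReal_binomKernel_left {t : ℝ} (h0 : 0 ≤ t) (h1 : t < 1) (m : ℕ) :
    ∑' n, ENNReal.ofReal (binomKernel t n m) = 1 := by
  have h := hasSum_binomKernel_left t m
  rw [← ENNReal.ofReal_tsum_of_nonneg (fun n => binomKernel_nonneg h0 h1 n m) h.summable,
    h.tsum_eq, ENNReal.ofReal_one]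

lemma tsum_ofReal_binomKernel_right {t : ℝ} (h0 : 0 ≤ t) (h1 : t < 1) (n : ℕ) :
    ∑' m, ENNReal.ofReal (binomKernel t n m) = ENNReal.ofReal (1 - t)⁻¹ := by
  have h := hasSum_binomKernel_right h0 h1 n
  rw [← ENNReal.ofReal_tsum_of_nonneg (fun m => binomKernel_nonneg h0 h1 n m) h.summable,
    h.tsum_eq]

/-- The product over all coordinates of the weights `binomKernel (t j) (ν j) (μ j)`. -/
def multiKernel (t : ℕ → ℝ) (ν μ : MIdx) : ℝ≥0∞ :=
  ∏ j ∈ ν.support ∪ μ.support, ENNReal.ofReal (binomKernel (t j) (ν j) (μ j))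

lemma multiKernel_eq_prod (t : ℕ → ℝ) {ν μ : MIdx} {S : Finset ℕ}
    (hν : ν.support ⊆ S) (hμ : μ.support ⊆ S) :
    multiKernel t ν μ = ∏ j ∈ S, ENNReal.ofReal (binomKernel (t j) (ν j) (μ j)) := by
  refine Finset.prod_subset (Finset.union_subset hν hμ) fun j _ hj => ?_
  simp only [Finset.mem_union, Finsupp.mem_support_iff, not_or, not_not] at hj
  simp [hj.1, hj.2]

/-- A sum of products over multi-indices supported in `S` is at most the product of the sums. -/
lemma sum_prod_le_prod_tsum (f : ℕ → ℕ → ℝ≥0∞) (s : Finset MIdx) (S : Finset ℕ)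
    (hS : ∀ μ ∈ s, μ.support ⊆ S) :
    ∑ μ ∈ s, ∏ j ∈ S, f j (μ j) ≤ ∏ j ∈ S, ∑' m, f j m := by
  classical
  let e : MIdx → ∀ j ∈ S, ℕ := fun μ j _ => μ j
  have hinj : Set.InjOn e s := by
    intro μ hμ μ' hμ' h
    ext j
    by_cases hj : j ∈ S
    · exact congrFun (congrFun h j) hj
    · rw [Finsupp.notMem_support_iff.1 fun h => hj (hS μ hμ h),
        Finsupp.notMem_support_iff.1 fun h => hj (hS μ' hμ' h)]
  let t : ℕ → Finset ℕ := fun j => s.image fun μ => μ j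
  calc ∑ μ ∈ s, ∏ j ∈ S, f j (μ j)
      = ∑ μ ∈ s, ∏ x ∈ S.attach, f x.1 (e μ x.1 x.2) :=
        Finset.sum_congr rfl fun μ _ => (Finset.prod_attach S fun j => f j (μ j)).symm
    _ = ∑ q ∈ s.image e, ∏ x ∈ S.attach, f x.1 (q x.1 x.2) :=
        (Finset.sum_image (f := fun q => ∏ x ∈ S.attach, f x.1 (q x.1 x.2)) hinj).symm
    _ ≤ ∑ q ∈ S.pi t, ∏ x ∈ S.attach, f x.1 (q x.1 x.2) := by
        refine Finset.sum_le_sum_of_subset fun q hq => ?_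
        obtain ⟨μ, hμ, rfl⟩ := Finset.mem_image.1 hq
        exact Finset.mem_pi.2 fun j _ => Finset.mem_image_of_mem _ hμ
    _ = ∏ j ∈ S, ∑ m ∈ t j, f j m := (Finset.prod_sum S t f).symm
    _ ≤ ∏ j ∈ S, ∑' m, f j m := Finset.prod_le_prod' fun j _ => ENNReal.sum_le_tsum _

lemma tsum_multiKernel_left_le {t : ℕ → ℝ} (h0 : ∀ j, 0 ≤ t j) (h1 : ∀ j, t j < 1)
    (μ : MIdx) : ∑' ν, multiKernel t ν μ ≤ 1 := by
  classical
  rw [ENNReal.tsum_eq_iSup_sum]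
  refine iSup_le fun s => ?_
  let S : Finset ℕ := μ.support ∪ s.biUnion Finsupp.support
  have hS : ∀ ν ∈ s, ν.support ⊆ S := fun ν hν =>
    (Finset.subset_biUnion_of_mem Finsupp.support hν).trans Finset.subset_union_right
  calc ∑ ν ∈ s, multiKernel t ν μ
      = ∑ ν ∈ s, ∏ j ∈ S, ENNReal.ofReal (binomKernel (t j) (ν j) (μ j)) :=
        Finset.sum_congr rfl fun ν hν =>
          multiKernel_eq_prod t (hS ν hν) Finset.subset_union_left
    _ ≤ ∏ j ∈ S, ∑' n, ENNReal.ofReal (binomKernel (t j) n (μ j)) :=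
        sum_prod_le_prod_tsum (fun j n => ENNReal.ofReal (binomKernel (t j) n (μ j))) s S hS
    _ = 1 := Finset.prod_eq_one fun j _ => tsum_ofReal_binomKernel_left (h0 j) (h1 j) _

lemma multipliable_one_sub_inv {t : ℕ → ℝ} (h0 : ∀ j, 0 ≤ t j) (h1 : ∀ j, t j < 1)
    (hsum : Summable t) : Multipliable fun j => (1 - t j)⁻¹ := by
  have hs : Summable fun j => t j / (1 - t j) := by
    refine (hsum.mul_left 2).of_norm_bounded_eventually_nat ?_
    filter_upwards [hsum.tendsto_atTop_zero.eventually_lt_const (by norm_num : (0 : ℝ) < 1 / 2)]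
      with j hj
    have hpos : 0 < 1 - t j := by linarith
    rw [Real.norm_of_nonneg (div_nonneg (h0 j) hpos.le), div_le_iff₀ hpos]
    nlinarith [h0 j]
  refine (Real.multipliable_one_add_of_summable hs).congr fun j => ?_
  have : 1 - t j ≠ 0 := by linarith [h1 j]
  field_simp
  ring

lemma prod_one_sub_inv_le_tprod {t : ℕ → ℝ} (h0 : ∀ j, 0 ≤ t j) (h1 : ∀ j, t j < 1)
    (hsum : Summable t) (S : Finset ℕ) :
    ∏ j ∈ S, (1 - t j)⁻¹ ≤ ∏' j, (1 - t j)⁻¹ := by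
  have h : Filter.Tendsto (fun S : Finset ℕ => ∏ j ∈ S, (1 - t j)⁻¹) Filter.atTop
      (nhds (∏' j, (1 - t j)⁻¹)) := (multipliable_one_sub_inv h0 h1 hsum).hasProd
  refine ge_of_tendsto h ?_
  filter_upwards [Filter.eventually_ge_atTop S] with S' hS'
  have hone : ∀ j, 1 ≤ (1 - t j)⁻¹ := fun j =>
    (one_le_inv₀ (by linarith [h1 j])).2 (by linarith [h0 j])
  exact Finset.prod_le_prod_of_subset_of_one_le hS' (fun j _ => zero_le_one.trans (hone j))
    fun j _ _ => hone j

lemma tsum_multiKernel_right_le {t : ℕ → ℝ} (h0 : ∀ j, 0 ≤ t j) (h1 : ∀ j, t j < 1)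
    (hsum : Summable t) (ν : MIdx) :
    ∑' μ, multiKernel t ν μ ≤ ENNReal.ofReal (∏' j, (1 - t j)⁻¹) := by
  classical
  rw [ENNReal.tsum_eq_iSup_sum]
  refine iSup_le fun s => ?_
  let S : Finset ℕ := ν.support ∪ s.biUnion Finsupp.support
  have hS : ∀ μ ∈ s, μ.support ⊆ S := fun μ hμ =>
    (Finset.subset_biUnion_of_mem Finsupp.support hμ).trans Finset.subset_union_right
  calc ∑ μ ∈ s, multiKernel t ν μ
      = ∑ μ ∈ s, ∏ j ∈ S, ENNReal.ofReal (binomKernel (t j) (ν j) (μ j)) :=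
        Finset.sum_congr rfl fun μ hμ =>
          multiKernel_eq_prod t Finset.subset_union_left (hS μ hμ)
    _ ≤ ∏ j ∈ S, ∑' m, ENNReal.ofReal (binomKernel (t j) (ν j) m) :=
        sum_prod_le_prod_tsum (fun j m => ENNReal.ofReal (binomKernel (t j) (ν j) m)) s S hS
    _ = ENNReal.ofReal (∏ j ∈ S, (1 - t j)⁻¹) := by
        rw [ENNReal.ofReal_prod_of_nonneg fun j _ => inv_nonneg.2 (by linarith [h1 j])]
        exact Finset.prod_congr rfl fun j _ => tsum_ofReal_binomKernel_right (h0 j) (h1 j) _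
    _ ≤ _ := ENNReal.ofReal_le_ofReal (prod_one_sub_inv_le_tprod h0 h1 hsum S)

lemma enorm_taylor_coeff {ρ y : ℕ → ℝ} (hρ : ∀ j, 1 < ρ j) (hy : ∀ j, |y j| ≤ 1)
    {ν μ : MIdx} (h : ν ≤ μ) :
    ENNReal.ofReal (mpow (fun j => ρ j - |y j|) ν) *
        ‖(mchoose μ ν : ℝ) * (mpow ρ μ)⁻¹ * mpow y (μ - ν)‖ₑ =
      multiKernel (fun j => |y j| / ρ j) ν μ := by
  have hsupp : ν.support ⊆ μ.support := Finsupp.support_mono h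
  have hsub : (μ - ν).support ⊆ μ.support := Finsupp.support_mono tsub_le_self
  have ht1 : ∀ j, |y j| / ρ j < 1 := fun j => by
    rw [div_lt_one (by linarith [hρ j])]
    linarith [hρ j, hy j]
  have ht0 : ∀ j, 0 ≤ |y j| / ρ j := fun j => div_nonneg (abs_nonneg _) (by linarith [hρ j])
  have hw : mpow (fun j => ρ j - |y j|) ν = ∏ j ∈ μ.support, (ρ j - |y j|) ^ ν j :=
    Finsupp.prod_of_support_subset _ hsupp _ fun _ _ => pow_zero _
  have hw0 : 0 ≤ mpow (fun j => ρ j - |y j|) ν := by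
    rw [hw]
    exact Finset.prod_nonneg fun j _ => pow_nonneg (by linarith [hρ j, hy j]) _
  have hd : mpow y (μ - ν) = ∏ j ∈ μ.support, y j ^ (μ j - ν j) :=
    Finsupp.prod_of_support_subset _ hsub _ fun _ _ => pow_zero _
  rw [multiKernel_eq_prod _ hsupp subset_rfl,
    ← ENNReal.ofReal_prod_of_nonneg fun j _ => binomKernel_nonneg (ht0 j) (ht1 j) _ _,
    ← ofReal_norm, ← ENNReal.ofReal_mul hw0, hw, hd]
  congr 1
  simp only [mchoose, mpow, Finsupp.prod, Nat.cast_prod, norm_mul, norm_inv, norm_prod, norm_pow,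
    Real.norm_eq_abs, Nat.abs_cast, ← Finset.prod_inv_distrib, ← Finset.prod_mul_distrib]
  refine Finset.prod_congr rfl fun j _ => ?_
  have hρ0 : 0 < ρ j := by linarith [hρ j]
  obtain ⟨k, hk⟩ := Nat.exists_eq_add_of_le (h j)
  rw [hk, binomKernel, Nat.add_sub_cancel_left, abs_of_pos hρ0, one_sub_div hρ0.ne', div_pow,
    div_pow, pow_add]
  field_simp

end BinomialKernel

section Schur

variable {ι κ : Type*} {K : ι → κ → ℝ≥0∞} {C : ℝ≥0∞}

lemma tsum_mul_le_rpow_mul_rpow (w f : ι → ℝ≥0∞) {p : ℝ} (hp : 1 ≤ p) :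
    ∑' i, w i * f i ≤ (∑' i, w i) ^ (1 - p⁻¹) * (∑' i, w i * f i ^ p) ^ p⁻¹ := by
  have h : 0 ≤ 1 - p⁻¹ := sub_nonneg.2 (inv_le_one_of_one_le₀ hp)
  rw [ENNReal.tsum_eq_iSup_sum]
  refine iSup_le fun s => (ENNReal.inner_le_weight_mul_Lp_of_nonneg s hp w f).trans ?_
  gcongr <;> exact ENNReal.sum_le_tsum s

/-- **Schur test**: a kernel with row sums at most `C` and column sums at most `1`
is bounded on `ℓ_p` with norm at most `C ^ (1 - 1 / p)`. -/
lemma schur_test (hrow : ∀ i, ∑' j, K i j ≤ C) (hcol : ∀ j, ∑' i, K i j ≤ 1)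
    (a : κ → ℝ≥0∞) {p : ℝ} (hp : 1 ≤ p) :
    (∑' i, (∑' j, K i j * a j) ^ p) ^ p⁻¹ ≤ C ^ (1 - p⁻¹) * (∑' j, a j ^ p) ^ p⁻¹ := by
  have hp0 : 0 < p := by linarith
  have h : 0 ≤ 1 - p⁻¹ := sub_nonneg.2 (inv_le_one_of_one_le₀ hp)
  have hpt : ∀ i, (∑' j, K i j * a j) ^ p ≤ (C ^ (1 - p⁻¹)) ^ p * ∑' j, K i j * a j ^ p := by
    intro i
    calc (∑' j, K i j * a j) ^ p
        ≤ (C ^ (1 - p⁻¹) * (∑' j, K i j * a j ^ p) ^ p⁻¹) ^ p := by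
          gcongr
          refine (tsum_mul_le_rpow_mul_rpow (K i) a hp).trans ?_
          gcongr
          exact hrow i
      _ = _ := by
          rw [ENNReal.mul_rpow_of_nonneg _ _ hp0.le, ENNReal.rpow_inv_rpow hp0.ne']
  have hsum : ∑' i, (∑' j, K i j * a j) ^ p ≤ (C ^ (1 - p⁻¹)) ^ p * ∑' j, a j ^ p := by
    refine (ENNReal.tsum_le_tsum hpt).trans ?_
    rw [ENNReal.tsum_mul_left, ENNReal.tsum_comm]
    gcongr with j
    rw [ENNReal.tsum_mul_right]
    exact mul_le_of_le_one_left' (hcol j)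
  calc _ ≤ ((C ^ (1 - p⁻¹)) ^ p * ∑' j, a j ^ p) ^ p⁻¹ := by gcongr
    _ = _ := by rw [ENNReal.mul_rpow_of_nonneg _ _ (by positivity), ENNReal.rpow_rpow_inv hp0.ne']

lemma tsum_mul_le_mul_iSup (hrow : ∀ i, ∑' j, K i j ≤ C) (a : κ → ℝ≥0∞) (i : ι) :
    ∑' j, K i j * a j ≤ C * ⨆ j, a j := by
  calc ∑' j, K i j * a j ≤ ∑' j, K i j * ⨆ j, a j := by
        gcongr with j
        exact le_iSup a j
    _ = (∑' j, K i j) * ⨆ j, a j := ENNReal.tsum_mul_right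
    _ ≤ _ := by gcongr; exact hrow i

end Schur

/-- The operator `T_{ρ,y}` mapping weighted Taylor coefficients at `0` to
weighted Taylor coefficients at `y` is bounded on `ℓ_p(F,X)` with norm at most
`(∏_j (1 - |y_j|/ρ_j)^{-1})^{1-1/p}`, provided `Σ_j |y_j|/ρ_j < ∞`.
The first conjunct asserts the absolute convergence of the series defining `T_{ρ,y} v`. -/
theorem operator_lp_bound
    {X : Type*} [NormedAddCommGroup X] [NormedSpace ℝ X] [CompleteSpace X]
    (ρ : ℕ → ℝ) (hρ : ∀ j, 1 < ρ j)
    (y : ℕ → ℝ) (hy : ∀ j, |y j| ≤ 1)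
    (hsum : Summable fun j => |y j| / ρ j)
    (p : ℝ≥0∞) (hp : 1 ≤ p)
    (v : MIdx → X) (hv : lpF p (fun ν => ‖v ν‖) ≠ ∞)
    (T : MIdx → X)
    (hT : ∀ ν : MIdx, T ν = mpow (fun j => ρ j - |y j|) ν •
      ∑' μ : {μ : MIdx // ν ≤ μ},
        ((mchoose μ.1 ν : ℝ) * (mpow ρ μ.1)⁻¹ * mpow y (μ.1 - ν)) • v μ.1) :
    (∀ ν : MIdx, Summable fun μ : {μ : MIdx // ν ≤ μ} =>
      ‖((mchoose μ.1 ν : ℝ) * (mpow ρ μ.1)⁻¹ * mpow y (μ.1 - ν)) • v μ.1‖) ∧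
    lpF p (fun ν => ‖T ν‖) ≤
      ENNReal.ofReal ((∏' j, (1 - |y j| / ρ j)⁻¹) ^ (1 - 1 / p.toReal)) *
        lpF p (fun ν => ‖v ν‖) := by
  set t : ℕ → ℝ := fun j => |y j| / ρ j with ht
  have ht1 : ∀ j, t j < 1 := fun j => by
    rw [ht, div_lt_one (by linarith [hρ j])]
    linarith [hρ j, hy j]
  have ht0 : ∀ j, 0 ≤ t j := fun j => div_nonneg (abs_nonneg _) (by linarith [hρ j])
  set C : ℝ := ∏' j, (1 - t j)⁻¹
  have hrow := tsum_multiKernel_right_le ht0 ht1 hsum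
  have hcol := tsum_multiKernel_left_le ht0 ht1
  have hC1 : 1 ≤ C := by simpa using prod_one_sub_inv_le_tprod ht0 ht1 hsum ∅
  set b : MIdx → ℝ≥0∞ := fun ν => ∑' μ, multiKernel t ν μ * ‖v μ‖ₑ
  let g (ν : MIdx) (μ : {μ : MIdx // ν ≤ μ}) : X :=
    ((mchoose μ.1 ν : ℝ) * (mpow ρ μ.1)⁻¹ * mpow y (μ.1 - ν)) • v μ.1
  have hw : ∀ ν, 0 < mpow (fun j => ρ j - |y j|) ν := fun ν =>
    Finset.prod_pos fun j _ => pow_pos (by linarith [hρ j, hy j]) _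
  have hg : ∀ ν, ENNReal.ofReal (mpow (fun j => ρ j - |y j|) ν) * ∑' μ, ‖g ν μ‖ₑ ≤ b ν := by
    intro ν
    calc _ = ∑' μ : {μ : MIdx // ν ≤ μ}, multiKernel t ν μ.1 * ‖v μ.1‖ₑ := by
          rw [← ENNReal.tsum_mul_left]
          refine tsum_congr fun μ => ?_
          rw [enorm_smul, ← mul_assoc, enorm_taylor_coeff hρ hy μ.2]
      _ ≤ b ν := ENNReal.tsum_comp_le_tsum_of_injective Subtype.val_injective _
  have hTb : ∀ ν, ‖T ν‖ₑ ≤ b ν := by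
    intro ν
    refine le_trans ?_ (hg ν)
    rw [hT ν, enorm_smul, Real.enorm_of_nonneg (hw ν).le]
    gcongr
    exact enorm_tsum_le_tsum_enorm
  have hofReal : ∀ {x : ℝ}, 0 ≤ x → ENNReal.ofReal C ^ x = ENNReal.ofReal (C ^ x) := fun hx =>
    ENNReal.ofReal_rpow_of_nonneg (by linarith) hx
  have hbound : (∀ ν, b ν ≠ ∞) ∧ lpF p (fun ν => ‖T ν‖) ≤
      ENNReal.ofReal (C ^ (1 - 1 / p.toReal)) * lpF p (fun ν => ‖v ν‖) := by
    by_cases hp' : p = ∞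
    · simp only [lpF, hp', if_true, ofReal_norm] at hv ⊢
      have hsup := tsum_mul_le_mul_iSup hrow fun μ => ‖v μ‖ₑ
      refine ⟨fun ν => ((hsup ν).trans_lt
        (ENNReal.mul_lt_top ENNReal.ofReal_lt_top hv.lt_top)).ne, ?_⟩
      simpa using fun ν => (hTb ν).trans (hsup ν)
    · have hp1 : 1 ≤ p.toReal := by
        simpa using ENNReal.toReal_mono hp' hp
      have hp0 : 0 < p.toReal := by linarith
      have h1 : 0 ≤ 1 - p.toReal⁻¹ := sub_nonneg.2 (inv_le_one_of_one_le₀ hp1)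
      simp only [lpF, hp', if_false, ofReal_norm, one_div] at hv ⊢
      have hschur := schur_test hrow hcol (fun μ => ‖v μ‖ₑ) hp1
      rw [hofReal h1] at hschur
      refine ⟨fun ν hν => ?_, le_trans ?_ hschur⟩
      · have hfin := (hschur.trans_lt (ENNReal.mul_lt_top ENNReal.ofReal_lt_top hv.lt_top)).ne
        refine hfin (top_le_iff.1 ?_)
        calc (∞ : ℝ≥0∞) = (b ν ^ p.toReal) ^ p.toReal⁻¹ := by
              rw [ENNReal.rpow_rpow_inv hp0.ne', hν]
          _ ≤ _ := by
              gcongr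
              exact ENNReal.le_tsum (f := fun ν => b ν ^ p.toReal) ν
      · gcongr with ν
        exact hTb ν
  refine ⟨fun ν => ?_, hbound.2⟩
  have hne : ∑' μ, ‖g ν μ‖ₑ ≠ ∞ := by
    intro h
    have := hg ν
    rw [h, ENNReal.mul_top (ENNReal.ofReal_pos.2 (hw ν)).ne'] at this
    exact hbound.1 ν (top_le_iff.1 this)
  refine Summable.of_enorm (f := fun μ => ‖g ν μ‖) ?_
  simpa only [enorm_norm] using hne
end
end

section
/- Let X be a Banach space, 1 ≤ p ≤ ∞, and 0 < q ≤ 1. Let ρ = (ρ_j)_{j≥1} satisfy ρ_min := inf_j ρ_j > 1 and (ρ_j^{-1})_{j≥1} ∈ ℓ_q(ℕ). Let (t_μ)_{μ∈F} ⊂ X with M := ‖(ρ^μ ‖t_μ‖_X)_{μ∈F}‖_{ℓ_p(F)} < ∞ and suppose u(y) = Σ_{μ∈F} t_μ y^μ converges absolutely for every y ∈ Y. Let ȳ ∈ Y and λ = (λ_j)_{j≥1} with 0 < λ_j ≤ 1 − |ȳ_j| for all j, and let Q := {y : |y_j − ȳ_j| ≤ λ_j for all j} ⊆ Y. Define the shifted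 Taylor coefficients s_ν := Σ_{μ≥ν} (μ!/((μ−ν)!ν!)) t_μ ȳ^{μ−ν} ∈ X and set ρ̃_j := (ρ_j − |ȳ_j|)/λ_j. Then for every integer m ≥ 0 there is a set Λ ⊆ F with #Λ = m+1 such that P_Q(y) := Σ_{ν∈Λ} s_ν (y − ȳ)^ν satisfies sup_{y∈Q} ‖u(y) − P_Q(y)‖_X ≤ C(ρ,q) · (∏_{j=1}^∞ (1 − |ȳ_j|/ρ_j)^{−1})^{1−1/p} · M · ‖(ρ̃_j^{-1})_{j≥1}‖_{ℓ_q(ℕ)} · (m+1)^{−r}, where r := −1 + 1/p + 1/q, C(ρ,q) := β^{1/q} exp((β/q)‖(ρ_j^{-1})‖_{ℓ_q}^q) and β := −ln(1 − ρ_min^{−q}) ρ_min^{q}. -/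
open scoped BigOperators ENNReal

noncomputable section

lemma sum_finsupp_prod {R : Type*} [CommSemiring R] (J : Finset ℕ) (T : ℕ → Finset ℕ)
    (f : ℕ → ℕ → R) :
    ∑ ν ∈ J.finsupp T, ∏ j ∈ J, f j (ν j) = ∏ j ∈ J, ∑ k ∈ T j, f j k := by
  rw [Finset.prod_sum, Finset.finsupp, Finset.sum_map]
  refine Finset.sum_congr (by congr!) fun e _ => ?_
  rw [← Finset.prod_attach J]
  refine Finset.prod_congr rfl fun j _ => ?_
  simp

lemma tsum_le_of_le_prod (f : ℕ → ℕ → ℝ≥0∞) (g : MIdx → ℝ≥0∞) (B : ℝ≥0∞) (J₀ : Finset ℕ)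
    (hg : ∀ (J : Finset ℕ) (μ : MIdx), J₀ ⊆ J → μ.support ⊆ J → g μ ≤ ∏ j ∈ J, f j (μ j))
    (hB : ∀ J : Finset ℕ, ∏ j ∈ J, ∑' k, f j k ≤ B) :
    ∑' μ, g μ ≤ B := by
  classical
  rw [ENNReal.tsum_eq_iSup_sum]
  refine iSup_le fun T => ?_
  set J := J₀ ∪ T.biUnion Finsupp.support
  have hT : ∀ μ ∈ T, μ.support ⊆ J := fun μ hμ =>
    (Finset.subset_biUnion_of_mem Finsupp.support hμ).trans Finset.subset_union_right
  calc ∑ μ ∈ T, g μ ≤ ∑ μ ∈ T, ∏ j ∈ J, f j (μ j) :=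
        Finset.sum_le_sum fun μ hμ => hg J μ Finset.subset_union_left (hT μ hμ)
    _ ≤ ∑ μ ∈ J.finsupp (fun j => T.image fun μ => μ j), ∏ j ∈ J, f j (μ j) := by
        refine Finset.sum_le_sum_of_subset fun μ hμ => ?_
        exact Finset.mem_finsupp_iff.2 ⟨hT μ hμ, fun j _ => Finset.mem_image_of_mem _ hμ⟩
    _ = ∏ j ∈ J, ∑ k ∈ T.image (fun μ => μ j), f j k := sum_finsupp_prod _ _ _
    _ ≤ ∏ j ∈ J, ∑' k, f j k := Finset.prod_le_prod' fun j _ => ENNReal.sum_le_tsum _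
    _ ≤ B := hB J

lemma mpow_eq_prod (x : ℕ → ℝ) {ν : MIdx} {J : Finset ℕ} (h : ν.support ⊆ J) :
    mpow x ν = ∏ j ∈ J, x j ^ ν j :=
  Finsupp.prod_of_support_subset _ h _ (by simp)

lemma mpow_zero_right (x : ℕ → ℝ) : mpow x 0 = 1 := by simp [mpow]

lemma mpow_nonneg {x : ℕ → ℝ} (hx : ∀ j, 0 ≤ x j) (ν : MIdx) : 0 ≤ mpow x ν :=
  Finset.prod_nonneg fun j _ => pow_nonneg (hx j) _

lemma mpow_pos {x : ℕ → ℝ} (hx : ∀ j, 0 < x j) (ν : MIdx) : 0 < mpow x ν :=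
  Finset.prod_pos fun j _ => pow_pos (hx j) _

lemma mpow_mul (x z : ℕ → ℝ) (ν : MIdx) :
    mpow (fun j => x j * z j) ν = mpow x ν * mpow z ν := by
  simp [mpow, Finsupp.prod, mul_pow, Finset.prod_mul_distrib]

lemma abs_mpow (x : ℕ → ℝ) (ν : MIdx) : |mpow x ν| = mpow (fun j => |x j|) ν := by
  simp [mpow, Finsupp.prod, Finset.abs_prod, abs_pow]

lemma mpow_le_mpow {x z : ℕ → ℝ} (hx : ∀ j, 0 ≤ x j) (h : ∀ j, x j ≤ z j) (ν : MIdx) :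
    mpow x ν ≤ mpow z ν :=
  Finset.prod_le_prod (fun j _ => pow_nonneg (hx j) _) fun j _ =>
    pow_le_pow_left₀ (hx j) (h j) _

/-- The term of index `ν` in the multinomial expansion of `(x + z)^μ`. -/
def binomTerm (x z : ℕ → ℝ) (μ ν : MIdx) : ℝ :=
  open Classical in if ν ≤ μ then mchoose μ ν * mpow x ν * mpow z (μ - ν) else 0

lemma binomTerm_eq_prod (x z : ℕ → ℝ) {μ ν : MIdx} {J : Finset ℕ} (hμ : μ.support ⊆ J)
    (hν : ν.support ⊆ J) :
    binomTerm x z μ ν = ∏ j ∈ J, ((μ j).choose (ν j) * x j ^ ν j * z j ^ (μ j - ν j)) := by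
  classical
  unfold binomTerm
  split_ifs with h
  · have h1 : (mchoose μ ν : ℝ) = ∏ j ∈ J, ((μ j).choose (ν j) : ℝ) := by
      rw [mchoose, Finsupp.prod, Finset.prod_subset hμ, Nat.cast_prod]
      intro j _ hj
      have h0 : μ j = 0 := by simpa using hj
      have := h j
      simp [h0, show ν j = 0 by omega]
    have h2 : (μ - ν).support ⊆ J := fun j hj => hμ <| by
      simp only [Finsupp.mem_support_iff, Finsupp.coe_tsub, Pi.sub_apply] at hj ⊢
      omega
    rw [h1, mpow_eq_prod x hν, mpow_eq_prod z h2, Finset.prod_mul_distrib,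
      Finset.prod_mul_distrib]
    simp
  · obtain ⟨j, hj⟩ : ∃ j, μ j < ν j := by
      by_contra! hc
      exact h hc
    refine (Finset.prod_eq_zero (i := j) (hν ?_) ?_).symm
    · simp only [Finsupp.mem_support_iff]; omega
    · simp [Nat.choose_eq_zero_of_lt hj]

lemma binomTerm_of_not_le (x z : ℕ → ℝ) {μ ν : MIdx} (h : ¬ν ≤ μ) : binomTerm x z μ ν = 0 := by
  simp [binomTerm, h]

lemma binomTerm_nonneg {x z : ℕ → ℝ} (hx : ∀ j, 0 ≤ x j) (hz : ∀ j, 0 ≤ z j) (μ ν : MIdx) :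
    0 ≤ binomTerm x z μ ν := by
  unfold binomTerm
  split_ifs
  · exact mul_nonneg (mul_nonneg (Nat.cast_nonneg _) (mpow_nonneg hx _)) (mpow_nonneg hz _)
  · exact le_rfl

lemma abs_binomTerm_le {x z x' z' : ℕ → ℝ} (hx : ∀ j, |x j| ≤ x' j) (hz : ∀ j, |z j| ≤ z' j)
    (μ ν : MIdx) : |binomTerm x z μ ν| ≤ binomTerm x' z' μ ν := by
  unfold binomTerm
  split_ifs
  · rw [abs_mul, abs_mul, Nat.abs_cast, abs_mpow, abs_mpow]
    have h1 := mpow_le_mpow (fun j => abs_nonneg (x j)) hx ν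
    have h2 := mpow_le_mpow (fun j => abs_nonneg (z j)) hz (μ - ν)
    have h3 := mpow_nonneg (fun j => abs_nonneg (x j)) ν
    have h4 := mpow_nonneg (fun j => abs_nonneg (z j)) (μ - ν)
    gcongr
    exact mul_nonneg (Nat.cast_nonneg _) (h3.trans h1)
  · simp

lemma binomTerm_mul_left (c x z : ℕ → ℝ) (μ ν : MIdx) :
    binomTerm (fun j => c j * x j) z μ ν = mpow c ν * binomTerm x z μ ν := by
  unfold binomTerm
  split_ifs
  · rw [mpow_mul]; ring
  · simp

lemma hasSum_binomTerm (x z : ℕ → ℝ) (μ : MIdx) :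
    HasSum (binomTerm x z μ) (mpow (fun j => x j + z j) μ) := by
  have hmem : ∀ ν : MIdx,
      ν ∈ μ.support.finsupp (fun j => Finset.range (μ j + 1)) ↔ ν ≤ μ := fun ν => by
    rw [Finset.mem_finsupp_iff]
    constructor
    · rintro ⟨h1, h2⟩ j
      by_cases hj : j ∈ μ.support
      · have := h2 j hj
        simp only [Finset.mem_range] at this
        omega
      · rw [Finsupp.notMem_support_iff.1 fun h => hj (h1 h)]
        exact Nat.zero_le _
    · intro h
      refine ⟨Finsupp.support_mono h, fun j _ => ?_⟩
      have := h j
      simp only [Finset.mem_range]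
      omega
  have hsum : ∑ ν ∈ μ.support.finsupp (fun j => Finset.range (μ j + 1)), binomTerm x z μ ν =
      mpow (fun j => x j + z j) μ := by
    rw [Finset.sum_congr rfl fun ν hν =>
      binomTerm_eq_prod x z subset_rfl (Finset.mem_finsupp_iff.1 hν).1,
      sum_finsupp_prod μ.support _
        fun j k => ((μ j).choose k : ℝ) * x j ^ k * z j ^ (μ j - k),
      mpow, Finsupp.prod]
    refine Finset.prod_congr rfl fun j _ => ?_
    rw [add_pow]
    exact Finset.sum_congr rfl fun k _ => by ring
  rw [← hsum]
  exact hasSum_sum_of_ne_finset_zero fun ν hν =>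
    binomTerm_of_not_le x z fun h => hν ((hmem ν).2 h)

lemma hasSum_choose_mul_pow (n : ℕ) {a ρ : ℝ} (ha : 0 ≤ a) (haρ : a < ρ) :
    HasSum (fun k : ℕ => (k.choose n * (ρ - a) ^ n * a ^ (k - n)) * (ρ⁻¹) ^ k)
      (1 - a / ρ)⁻¹ := by
  have hρ : 0 < ρ := ha.trans_lt haρ
  have h1 : ‖a / ρ‖ < 1 := by
    rw [Real.norm_of_nonneg (by positivity), div_lt_one hρ]
    exact haρ
  have h := (hasSum_choose_mul_geometric_of_norm_lt_one n h1).mul_left (((ρ - a) / ρ) ^ n)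
  have hne : ρ - a ≠ 0 := (sub_pos.2 haρ).ne'
  have hval : ((ρ - a) / ρ) ^ n * (1 / (1 - a / ρ) ^ (n + 1)) = (1 - a / ρ)⁻¹ := by
    rw [show 1 - a / ρ = (ρ - a) / ρ by field_simp]
    have : (ρ - a) / ρ ≠ 0 := div_ne_zero hne hρ.ne'
    rw [pow_succ]
    field_simp
  rw [hval] at h
  refine (hasSum_iff_hasSum_of_ne_zero_bij (fun k : Function.support _ => (k : ℕ) + n)
    (fun x y hxy => ?_) ?_ ?_).2 h
  · exact Subtype.ext (by simpa using hxy)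
  · intro k hk
    have hkn : n ≤ k := by
      by_contra! hc
      simp [Nat.choose_eq_zero_of_lt hc] at hk
    obtain ⟨i, rfl⟩ := Nat.exists_eq_add_of_le' hkn
    refine ⟨⟨i, fun h0 => hk ?_⟩, rfl⟩
    simp only [Nat.add_sub_cancel]
    rw [← h0]
    simp only [div_pow, inv_pow, pow_add]
    field_simp
  · rintro ⟨i, _⟩
    simp only [Nat.add_sub_cancel, div_pow, inv_pow, pow_add]
    field_simp

lemma tsum_binomTerm_div_le {a ρ : ℕ → ℝ} (ha : ∀ j, 0 ≤ a j) (haρ : ∀ j, a j < ρ j) {A : ℝ}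
    (hA : ∀ J : Finset ℕ, ∏ j ∈ J, (1 - a j / ρ j)⁻¹ ≤ A) (ν : MIdx) :
    ∑' μ, ENNReal.ofReal (binomTerm (fun j => ρ j - a j) a μ ν * mpow (fun j => (ρ j)⁻¹) μ) ≤
      ENNReal.ofReal A := by
  have hρ : ∀ j, 0 < ρ j := fun j => (ha j).trans_lt (haρ j)
  have hpos : ∀ j k, 0 ≤ ((k.choose (ν j) : ℝ) * (ρ j - a j) ^ ν j * a j ^ (k - ν j)) *
      ((ρ j)⁻¹) ^ k := fun j k => by
    have := ha j
    have := hρ j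
    have := sub_pos.2 (haρ j)
    positivity
  refine tsum_le_of_le_prod (fun j k => ENNReal.ofReal
    ((k.choose (ν j) * (ρ j - a j) ^ ν j * a j ^ (k - ν j)) * ((ρ j)⁻¹) ^ k)) _ _ ν.support ?_ ?_
  · intro J μ hν hμ
    rw [binomTerm_eq_prod _ _ hμ hν, mpow_eq_prod _ hμ, ← Finset.prod_mul_distrib,
      ENNReal.ofReal_prod_of_nonneg fun j _ => hpos j _]
  · intro J
    have h : ∀ j, ∑' k : ℕ, ENNReal.ofReal
        ((k.choose (ν j) * (ρ j - a j) ^ ν j * a j ^ (k - ν j)) * ((ρ j)⁻¹) ^ k) =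
        ENNReal.ofReal (1 - a j / ρ j)⁻¹ := fun j => by
      have hs := hasSum_choose_mul_pow (ν j) (ha j) (haρ j)
      rw [← ENNReal.ofReal_tsum_of_nonneg (hpos j) hs.summable, hs.tsum_eq]
    simp_rw [h]
    rw [← ENNReal.ofReal_prod_of_nonneg]
    · exact ENNReal.ofReal_le_ofReal (hA J)
    · intro j _
      have : a j / ρ j < 1 := (div_lt_one (hρ j)).2 (haρ j)
      exact inv_nonneg.2 (by linarith)

lemma tsum_mpow_le {x : ℕ → ℝ} (hx : ∀ j, 0 ≤ x j) (hx1 : ∀ j, x j < 1) {B : ℝ}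
    (hB : ∀ J : Finset ℕ, ∏ j ∈ J, (1 - x j)⁻¹ ≤ B) :
    ∑' ν, ENNReal.ofReal (mpow x ν) ≤ ENNReal.ofReal B := by
  refine tsum_le_of_le_prod (fun j k => ENNReal.ofReal (x j ^ k)) _ _ ∅ ?_ ?_
  · intro J ν _ hν
    rw [mpow_eq_prod _ hν, ENNReal.ofReal_prod_of_nonneg fun j _ => pow_nonneg (hx j) _]
  · intro J
    have h : ∀ j, ∑' k : ℕ, ENNReal.ofReal (x j ^ k) = ENNReal.ofReal (1 - x j)⁻¹ := fun j => by
      rw [← ENNReal.ofReal_tsum_of_nonneg (fun k => pow_nonneg (hx j) k)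
        (summable_geometric_of_lt_one (hx j) (hx1 j)), tsum_geometric_of_lt_one (hx j) (hx1 j)]
    simp_rw [h]
    rw [← ENNReal.ofReal_prod_of_nonneg fun j _ => inv_nonneg.2 (sub_pos.2 (hx1 j)).le]
    exact ENNReal.ofReal_le_ofReal (hB J)

lemma tsum_mul_le_Lp_mul_Lq {ι : Type*} (f g : ι → ℝ≥0∞) {P Q : ℝ}
    (h : P.HolderConjugate Q) :
    ∑' i, f i * g i ≤ (∑' i, f i ^ P) ^ (1 / P) * (∑' i, g i ^ Q) ^ (1 / Q) := by
  rw [ENNReal.tsum_eq_iSup_sum]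
  refine iSup_le fun s => (ENNReal.inner_le_Lp_mul_Lq s f g h).trans ?_
  have := h.pos
  have := h.symm.pos
  gcongr <;> exact ENNReal.sum_le_tsum s

lemma le_of_rpow_le_div {d S n : ℝ≥0∞} {q : ℝ} (hq : 0 < q) (h : d ^ q ≤ S / n) :
    d ≤ S ^ (1 / q) * n ^ (-(1 / q)) := by
  have hq' : 0 ≤ 1 / q := by positivity
  calc d = (d ^ q) ^ (1 / q) := by
        rw [← ENNReal.rpow_mul, mul_one_div_cancel hq.ne', ENNReal.rpow_one]
    _ ≤ (S / n) ^ (1 / q) := by gcongr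
    _ = _ := by rw [ENNReal.div_rpow_of_nonneg _ _ hq', ENNReal.rpow_neg, div_eq_mul_inv]

/-- Stechkin's inequality for a family that is pointwise below the threshold `S / n`. -/
lemma tsum_rpow_le_of_rpow_le_div {ι : Type*} {d : ι → ℝ≥0∞} {S n : ℝ≥0∞} {q Q : ℝ} (hq : 0 < q)
    (hqQ : q ≤ Q) (hS : S ≠ 0) (hS' : S ≠ ∞)
    (h : ∀ i, d i ^ q ≤ S / n) (hsum : ∑' i, d i ^ q ≤ S) :
    (∑' i, d i ^ Q) ^ (1 / Q) ≤ S ^ (1 / q) * n ^ (-(1 / q - 1 / Q)) := by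
  have hQ : 0 < Q := hq.trans_le hqQ
  have hQ' : 0 ≤ 1 / Q := by positivity
  have he : 0 ≤ (Q - q) / q := div_nonneg (by linarith) hq.le
  have hstep : ∀ i, d i ^ Q ≤ (S / n) ^ ((Q - q) / q) * d i ^ q := fun i =>
    calc d i ^ Q = (d i ^ q) ^ ((Q - q) / q) * d i ^ q := by
          rw [← ENNReal.rpow_mul, ← ENNReal.rpow_add_of_nonneg]
          · congr 1; field_simp; ring
          · rw [mul_div_cancel₀ _ hq.ne']; linarith
          · exact hq.le
      _ ≤ _ := by gcongr; exact h i
  calc (∑' i, d i ^ Q) ^ (1 / Q) ≤ ((S / n) ^ ((Q - q) / q) * S) ^ (1 / Q) := by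
        gcongr
        calc ∑' i, d i ^ Q ≤ ∑' i, (S / n) ^ ((Q - q) / q) * d i ^ q :=
              ENNReal.tsum_le_tsum hstep
          _ = (S / n) ^ ((Q - q) / q) * ∑' i, d i ^ q := ENNReal.tsum_mul_left
          _ ≤ _ := by gcongr
    _ = S ^ (1 / q) * n ^ (-(1 / q - 1 / Q)) := by
        rw [ENNReal.mul_rpow_of_nonneg _ _ hQ', ← ENNReal.rpow_mul, div_eq_mul_inv,
          ENNReal.mul_rpow_of_nonneg _ _ (by positivity), ENNReal.inv_rpow, ← ENNReal.rpow_neg,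
          mul_right_comm, ← ENNReal.rpow_add _ _ hS hS']
        congr 2 <;> field_simp
        ring

lemma exists_finset_card_forall_notMem_le {ι : Type*} [Infinite ι] {f : ι → ℝ≥0∞} {S : ℝ≥0∞}
    (hS : S ≠ 0) (hS' : S ≠ ∞) (hsum : ∑' i, f i ≤ S) (i₀ : ι) (m : ℕ) :
    ∃ Λ : Finset ι, Λ.card = m + 1 ∧ i₀ ∈ Λ ∧ ∀ i ∉ Λ, f i ≤ S / ((m : ℝ≥0∞) + 1) := by
  classical
  set ε : ℝ≥0∞ := S / ((m : ℝ≥0∞) + 1) with hε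
  have hm0 : (m : ℝ≥0∞) + 1 ≠ 0 := by positivity
  have hm1 : (m : ℝ≥0∞) + 1 ≠ ∞ := by finiteness
  have hε0 : ε ≠ 0 := ENNReal.div_ne_zero.2 ⟨hS, hm1⟩
  obtain ⟨hf, -⟩ := ENNReal.finset_card_const_le_le_of_tsum_le hS' hsum hε0
  have hfin : {i | ε < f i}.Finite := hf.subset fun i (hi : ε < f i) => hi.le
  set T := hfin.toFinset
  have hcard : T.card ≤ m := by
    by_contra! hc
    have hne : T.Nonempty := Finset.card_pos.1 (by omega)
    have hεtop : ε ≠ ∞ := ENNReal.div_ne_top hS' hm0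
    have h1 : ∑ _i ∈ T, ε < ∑ i ∈ T, f i := by
      refine ENNReal.sum_lt_sum_of_nonempty hne fun i hi => ?_
      simpa [T] using hi
    have h2 : S ≤ ∑ _i ∈ T, ε := by
      rw [Finset.sum_const, nsmul_eq_mul]
      calc S = ((m : ℝ≥0∞) + 1) * ε := (ENNReal.mul_div_cancel hm0 hm1).symm
        _ ≤ (T.card : ℝ≥0∞) * ε := by gcongr; exact_mod_cast hc
    exact absurd ((h2.trans_lt h1).trans_le ((ENNReal.sum_le_tsum T).trans hsum)) (lt_irrefl _)
  obtain ⟨Λ, hsub, hΛ⟩ := Infinite.exists_superset_card_eq (insert i₀ T) (m + 1)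
    ((Finset.card_insert_le _ _).trans (by omega))
  refine ⟨Λ, hΛ, hsub (Finset.mem_insert_self _ _), fun i hi => ?_⟩
  by_contra! hc
  exact hi (hsub (Finset.mem_insert_of_mem (by simpa [T] using hc)))

/-- A Schur-type estimate: a kernel `k` with row sums at most `A` and column sums at most `1`,
applied to `a ∈ ℓ_p` and integrated against a family `d` satisfying Stechkin's condition. -/
lemma tsum_tsum_kernel_le {ι : Type*} {d : ι → ℝ≥0∞} {k : ι → MIdx → ℝ≥0∞} {a : MIdx → ℝ}
    {A S n p : ℝ≥0∞} {q : ℝ} (hp : 1 ≤ p) (hq0 : 0 < q) (hq1 : q ≤ 1)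
    (hS : S ≠ 0) (hS' : S ≠ ∞)
    (h : ∀ i, d i ^ q ≤ S / n) (hsum : ∑' i, d i ^ q ≤ S)
    (hrow : ∀ i, ∑' μ, k i μ ≤ A) (hcol : ∀ μ, ∑' i, k i μ ≤ 1) :
    ∑' i, ∑' μ, d i * k i μ * ENNReal.ofReal (a μ) ≤
      A ^ (1 - 1 / p.toReal) * lpF p a *
        (S ^ (1 / q) * n ^ (-(-1 + 1 / p.toReal + 1 / q))) := by
  rcases eq_or_ne p ∞ with rfl | hptop
  · have hd := tsum_rpow_le_of_rpow_le_div (Q := 1) hq0 hq1 hS hS' h hsum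
    simp only [ENNReal.rpow_one, div_one] at hd
    have ha : ∀ μ, ENNReal.ofReal (a μ) ≤ lpF ∞ a := fun μ => by
      simpa [lpF] using le_iSup (fun ν => ENNReal.ofReal (a ν)) μ
    calc ∑' i, ∑' μ, d i * k i μ * ENNReal.ofReal (a μ)
        ≤ ∑' i, d i * (A * lpF ∞ a) := by
          refine ENNReal.tsum_le_tsum fun i => ?_
          simp_rw [mul_assoc]
          rw [ENNReal.tsum_mul_left]
          gcongr
          calc ∑' μ, k i μ * ENNReal.ofReal (a μ) ≤ ∑' μ, k i μ * lpF ∞ a :=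
                ENNReal.tsum_le_tsum fun μ => by gcongr; exact ha μ
            _ ≤ A * lpF ∞ a := by rw [ENNReal.tsum_mul_right]; gcongr; exact hrow i
      _ = A * lpF ∞ a * ∑' i, d i := by rw [ENNReal.tsum_mul_right, mul_comm]
      _ ≤ A * lpF ∞ a * (S ^ (1 / q) * n ^ (-(1 / q - 1))) := by gcongr
      _ = _ := by
          simp only [ENNReal.toReal_top, div_zero, sub_zero, ENNReal.rpow_one, add_zero]
          congr 3; ring
  have hlp : lpF p a = (∑' ν, ENNReal.ofReal (a ν) ^ p.toReal) ^ (1 / p.toReal) := by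
    simp [lpF, hptop]
  have hp1 : 1 ≤ p.toReal := by
    simpa using ENNReal.toReal_mono hptop hp
  rcases hp1.eq_or_lt with hp1' | hp1'
  · rw [hlp, ← hp1']
    simp only [ENNReal.rpow_one, div_one, sub_self, ENNReal.rpow_zero, one_mul, neg_add_cancel,
      zero_add]
    calc ∑' i, ∑' μ, d i * k i μ * ENNReal.ofReal (a μ)
        ≤ ∑' i, ∑' μ, (S ^ (1 / q) * n ^ (-(1 / q))) * (k i μ * ENNReal.ofReal (a μ)) := by
          refine ENNReal.tsum_le_tsum fun i => ENNReal.tsum_le_tsum fun μ => ?_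
          rw [mul_assoc]
          gcongr
          exact le_of_rpow_le_div hq0 (h i)
      _ = (S ^ (1 / q) * n ^ (-(1 / q))) * ∑' μ, (∑' i, k i μ) * ENNReal.ofReal (a μ) := by
          simp_rw [ENNReal.tsum_mul_left]
          rw [ENNReal.tsum_comm]
          simp_rw [ENNReal.tsum_mul_right]
      _ ≤ (S ^ (1 / q) * n ^ (-(1 / q))) * ∑' μ, ENNReal.ofReal (a μ) := by
          gcongr with μ
          exact mul_le_of_le_one_left' (hcol μ)
      _ = _ := mul_comm _ _
  · set P := p.toReal
    have hPQ : P.conjExponent.HolderConjugate P :=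
      (Real.HolderConjugate.conjExponent hp1').symm
    set Q := P.conjExponent
    have hQ0 : 0 < Q := hPQ.pos
    have hP0 : 0 < P := hPQ.symm.pos
    have hQ1 : 1 ≤ Q := hPQ.lt.le
    have hconj : 1 / Q + 1 / P = 1 := by simpa using hPQ.inv_add_inv_eq_one
    have hd := tsum_rpow_le_of_rpow_le_div (Q := Q) hq0 (hq1.trans hQ1) hS hS' h hsum
    have hroot : ∀ {x : ℝ≥0∞} {R : ℝ}, 0 < R → (x ^ (1 / R)) ^ R = x := fun hR => by
      rw [← ENNReal.rpow_mul, one_div_mul_cancel hR.ne', ENNReal.rpow_one]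
    calc ∑' i, ∑' μ, d i * k i μ * ENNReal.ofReal (a μ)
        = ∑' z : ι × MIdx, (d z.1 * k z.1 z.2 ^ (1 / Q)) *
            (k z.1 z.2 ^ (1 / P) * ENNReal.ofReal (a z.2)) := by
          rw [← ENNReal.tsum_prod]
          refine tsum_congr fun z => ?_
          have : k z.1 z.2 = k z.1 z.2 ^ (1 / Q) * k z.1 z.2 ^ (1 / P) := by
            rw [← ENNReal.rpow_add_of_nonneg _ _ (by positivity) (by positivity), hconj,
              ENNReal.rpow_one]
          conv_lhs => rw [this]
          ring
      _ ≤ (∑' z : ι × MIdx, (d z.1 * k z.1 z.2 ^ (1 / Q)) ^ Q) ^ (1 / Q) *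
          (∑' z : ι × MIdx, (k z.1 z.2 ^ (1 / P) * ENNReal.ofReal (a z.2)) ^ P) ^ (1 / P) :=
          tsum_mul_le_Lp_mul_Lq _ _ hPQ
      _ ≤ (A * ∑' i, d i ^ Q) ^ (1 / Q) * (∑' μ, ENNReal.ofReal (a μ) ^ P) ^ (1 / P) := by
          simp_rw [ENNReal.mul_rpow_of_nonneg _ _ hQ0.le, ENNReal.mul_rpow_of_nonneg _ _ hP0.le,
            hroot hQ0, hroot hP0]
          gcongr
          · rw [ENNReal.tsum_prod (f := fun i μ => d i ^ Q * k i μ), ← ENNReal.tsum_mul_left]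
            refine ENNReal.tsum_le_tsum fun i => ?_
            rw [ENNReal.tsum_mul_left, mul_comm]
            gcongr
            exact hrow i
          · rw [ENNReal.tsum_prod (f := fun i μ => k i μ * ENNReal.ofReal (a μ) ^ P),
              ENNReal.tsum_comm]
            refine ENNReal.tsum_le_tsum fun μ => ?_
            rw [ENNReal.tsum_mul_right]
            exact mul_le_of_le_one_left' (hcol μ)
      _ ≤ A ^ (1 / Q) * (S ^ (1 / q) * n ^ (-(1 / q - 1 / Q))) * lpF p a := by
          rw [ENNReal.mul_rpow_of_nonneg _ _ (by positivity), ← hlp]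
          gcongr
      _ = _ := by
          rw [show 1 / Q = 1 - 1 / P by linarith,
            show 1 / q - (1 - 1 / P) = -1 + 1 / P + 1 / q by ring]
          ring

/-- The remainder after truncating the re-expanded power series is controlled by the tail of the
absolute double series. -/
lemma enorm_tsum_sub_sum_le {X : Type*} [NormedAddCommGroup X] [NormedSpace ℝ X] [CompleteSpace X]
    {t s : MIdx → X} {y ybar lam : ℕ → ℝ}
    (hsum : Summable fun μ : MIdx => mpow (fun j => lam j + |ybar j|) μ * ‖t μ‖)
    (hs : ∀ ν : MIdx, s ν = ∑' μ : {μ : MIdx // ν ≤ μ},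
      ((mchoose μ.1 ν : ℝ) * mpow ybar (μ.1 - ν)) • t μ.1)
    (hy : ∀ j, |y j - ybar j| ≤ lam j) (Λ : Finset MIdx) :
    ‖(∑' μ : MIdx, mpow y μ • t μ) - ∑ ν ∈ Λ, mpow (fun j => y j - ybar j) ν • s ν‖ₑ ≤
      ∑' ν : ((Λ : Set MIdx)ᶜ : Set MIdx), ∑' μ : MIdx,
        ENNReal.ofReal (binomTerm lam (fun j => |ybar j|) μ ν * ‖t μ‖) := by
  classical
  have hlam : ∀ j, 0 ≤ lam j := fun j => (abs_nonneg _).trans (hy j)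
  have hnn : ∀ μ ν, 0 ≤ binomTerm lam (fun j => |ybar j|) μ ν :=
    binomTerm_nonneg hlam fun j => abs_nonneg _
  set v : MIdx → MIdx → X := fun μ ν => binomTerm (fun j => y j - ybar j) ybar μ ν • t μ with hv
  have hvle : ∀ μ ν, ‖v μ ν‖ ≤ binomTerm lam (fun j => |ybar j|) μ ν * ‖t μ‖ := fun μ ν => by
    rw [hv, norm_smul, Real.norm_eq_abs]
    gcongr
    exact abs_binomTerm_le hy (fun j => le_rfl) μ ν
  have hmaj : Summable fun z : MIdx × MIdx =>
      binomTerm lam (fun j => |ybar j|) z.1 z.2 * ‖t z.1‖ := by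
    rw [summable_prod_of_nonneg fun z => mul_nonneg (hnn _ _) (norm_nonneg _)]
    have h := fun μ => (hasSum_binomTerm lam (fun j => |ybar j|) μ).mul_right ‖t μ‖
    exact ⟨fun μ => (h μ).summable, by simpa only [(h _).tsum_eq] using hsum⟩
  have hvsum : Summable (Function.uncurry v) :=
    Summable.of_norm_bounded hmaj fun z => hvle z.1 z.2
  have hu : ∑' μ : MIdx, mpow y μ • t μ = ∑' μ, ∑' ν, v μ ν := by
    refine tsum_congr fun μ => ?_
    have h := (hasSum_binomTerm (fun j => y j - ybar j) ybar μ).smul_const (t μ)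
    simp only [sub_add_cancel] at h
    exact h.tsum_eq.symm
  have hg : ∀ ν, mpow (fun j => y j - ybar j) ν • s ν = ∑' μ, v μ ν := fun ν => by
    rw [hs, ← tsum_const_smul'']
    refine (tsum_subtype {μ : MIdx | ν ≤ μ} fun μ =>
      mpow (fun j => y j - ybar j) ν • ((mchoose μ ν : ℝ) * mpow ybar (μ - ν)) • t μ).trans
      (tsum_congr fun μ => ?_)
    by_cases h : ν ≤ μ
    · simp only [Set.indicator, Set.mem_ofPred_eq, h, if_true, hv, binomTerm, smul_smul]
      congr 1; ring
    · simp [Set.indicator, h, hv, binomTerm]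
  have hswap : ∑' μ, ∑' ν, v μ ν = ∑' ν, ∑' μ, v μ ν := hvsum.tsum_comm.symm
  have hgsum : Summable fun ν => ∑' μ, v μ ν :=
    ((Equiv.prodComm MIdx MIdx).summable_iff.2 hvsum).prod
  simp_rw [hg]
  rw [hu, hswap, ← hgsum.sum_add_tsum_compl (s := Λ), add_sub_cancel_left]
  refine enorm_tsum_le_tsum_enorm.trans (ENNReal.tsum_le_tsum fun ν => ?_)
  refine enorm_tsum_le_tsum_enorm.trans (ENNReal.tsum_le_tsum fun μ => ?_)
  rw [← ofReal_norm]
  exact ENNReal.ofReal_le_ofReal (hvle μ ν)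

lemma inv_one_sub_le_exp {x x₀ : ℝ} (hx : 0 ≤ x) (hxx₀ : x ≤ x₀) (hx₀ : 0 < x₀) (hx₀' : x₀ < 1) :
    (1 - x)⁻¹ ≤ Real.exp (-Real.log (1 - x₀) * x₀⁻¹ * x) := by
  have hc := strictConcaveOn_log_Ioi.concaveOn.2 (Set.mem_Ioi.2 one_pos)
    (Set.mem_Ioi.2 (sub_pos.2 hx₀'))
    (sub_nonneg.2 ((div_le_one hx₀).2 hxx₀)) (div_nonneg hx hx₀.le) (sub_add_cancel 1 (x / x₀))
  simp only [smul_eq_mul, Real.log_one, mul_zero, zero_add] at hc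
  rw [show (1 - x / x₀) * 1 + x / x₀ * (1 - x₀) = 1 - x by
    field_simp; ring] at hc
  have h1 : 0 < 1 - x := by linarith
  rw [← Real.exp_log (inv_pos.2 h1), Real.log_inv]
  refine Real.exp_le_exp.2 ?_
  rw [show -Real.log (1 - x₀) * x₀⁻¹ * x = -(x / x₀ * Real.log (1 - x₀)) by
    rw [div_eq_mul_inv]; ring]
  linarith

lemma exp_sub_one_le_mul_exp (x : ℝ) : Real.exp x - 1 ≤ x * Real.exp x := by
  have h := Real.add_one_le_exp (-x)
  have h2 : Real.exp (-x) * Real.exp x = 1 := by rw [← Real.exp_add]; simp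
  nlinarith [Real.exp_pos x]

lemma prod_inv_one_sub_le_tprod {x : ℕ → ℝ} {c : ℝ} (hc : c < 1) (hx : ∀ j, 0 ≤ x j)
    (hxc : ∀ j, x j ≤ c) (hsum : Summable x) (J : Finset ℕ) :
    ∏ j ∈ J, (1 - x j)⁻¹ ≤ ∏' j, (1 - x j)⁻¹ := by
  have hpos : ∀ j, 0 < 1 - x j := fun j => by linarith [hxc j]
  have hone : ∀ j, 1 ≤ (1 - x j)⁻¹ := fun j => (one_le_inv₀ (hpos j)).2 (by linarith [hx j])
  have hmul : Multipliable fun j => (1 - x j)⁻¹ := by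
    have h : Summable fun j => x j / (1 - x j) := by
      refine Summable.of_nonneg_of_le (fun j => div_nonneg (hx j) (hpos j).le) (fun j => ?_)
        (hsum.mul_right (1 - c)⁻¹)
      rw [div_eq_mul_inv]
      exact mul_le_mul_of_nonneg_left
        (inv_anti₀ (by linarith) (by linarith [hxc j])) (hx j)
    refine (Real.multipliable_one_add_of_summable h).congr fun j => ?_
    have := (hpos j).ne'
    field_simp
    ring
  refine ge_of_tendsto hmul.hasProd ?_
  filter_upwards [Filter.eventually_ge_atTop J] with J' hJ'
  exact Finset.prod_le_prod_of_subset_of_one_le hJ'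
    (fun j _ => zero_le_one.trans (hone j)) fun j _ _ => hone j

lemma tsum_ite_mpow_rpow_le {x : ℕ → ℝ} {x₀ b q : ℝ} (hq : 0 < q) (hx : ∀ j, 0 ≤ x j)
    (hxx₀ : ∀ j, x j ^ q ≤ x₀) (hx₀ : 0 < x₀) (hx₀' : x₀ < 1) (hsum : Summable fun j => x j ^ q)
    (hb : b = -Real.log (1 - x₀) * x₀⁻¹) (hb0 : 0 ≤ b) :
    ∑' ν : MIdx, (if ν = 0 then 0 else ENNReal.ofReal (mpow x ν) ^ q) ≤
      ENNReal.ofReal (b * (∑' j, x j ^ q) * Real.exp (b * ∑' j, x j ^ q)) := by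
  have hxq : ∀ j, 0 ≤ x j ^ q := fun j => Real.rpow_nonneg (hx j) q
  have hpow : ∀ ν, ENNReal.ofReal (mpow x ν) ^ q =
      ENNReal.ofReal (mpow (fun j => x j ^ q) ν) := fun ν => by
    rw [ENNReal.ofReal_rpow_of_nonneg (mpow_nonneg hx ν) hq.le]
    congr 1
    rw [mpow, mpow, Finsupp.prod, Finsupp.prod,
      ← Real.finsetProd_rpow _ _ fun j _ => pow_nonneg (hx j) _]
    exact Finset.prod_congr rfl fun j _ => (Real.rpow_pow_comm (hx j) _ _).symm
  have hB : ∀ J : Finset ℕ, ∏ j ∈ J, (1 - x j ^ q)⁻¹ ≤ Real.exp (b * ∑' j, x j ^ q) := fun J =>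
    calc ∏ j ∈ J, (1 - x j ^ q)⁻¹ ≤ ∏ j ∈ J, Real.exp (b * x j ^ q) :=
          Finset.prod_le_prod (fun j _ => inv_nonneg.2 (by linarith [hxx₀ j])) fun j _ => by
            rw [hb]; exact inv_one_sub_le_exp (hxq j) (hxx₀ j) hx₀ hx₀'
      _ = Real.exp (b * ∑ j ∈ J, x j ^ q) := by rw [← Real.exp_sum, Finset.mul_sum]
      _ ≤ _ := by
          gcongr
          exact hsum.sum_le_tsum J fun j _ => hxq j
  have h := tsum_mpow_le hxq (fun j => (hxx₀ j).trans_lt hx₀') hB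
  rw [ENNReal.tsum_eq_add_tsum_ite 0, mpow_zero_right, ENNReal.ofReal_one] at h
  simp_rw [hpow]
  have h' := ENNReal.le_sub_of_add_le_left ENNReal.one_ne_top h
  rw [← ENNReal.ofReal_one, ← ENNReal.ofReal_sub _ zero_le_one] at h'
  refine le_trans (le_of_eq ?_) (h'.trans (ENNReal.ofReal_le_ofReal (exp_sub_one_le_mul_exp _)))
  exact tsum_congr fun ν => by congr

/-- Local Taylor approximation error estimate (Theorem `local_v1`):
for `u ∈ B_{ρ,p}` with `0 < q ≤ 1`, `(ρ_j^{-1}) ∈ ℓ_q(ℕ)`, a hyperrectangle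
`Q = {y : |y_j - ȳ_j| ≤ λ_j}` inside `Y`, and the shifted Taylor coefficients
`s_ν = Σ_{μ≥ν} (μ!/((μ-ν)!ν!)) t_μ ȳ^{μ-ν}`, there is a set `Λ` with `m+1` terms such that
`sup_{y∈Q} ‖u(y) − Σ_{ν∈Λ} s_ν (y-ȳ)^ν‖ ≤
  C(ρ,q) (∏_j (1-|ȳ_j|/ρ_j)^{-1})^{1-1/p} M ‖(ρ̃_j^{-1})‖_{ℓ_q} (m+1)^{-r}`
with `ρ̃_j = (ρ_j - |ȳ_j|)/λ_j`. -/
theorem local_taylor_error_v1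
    {X : Type*} [NormedAddCommGroup X] [NormedSpace ℝ X] [CompleteSpace X]
    (p : ℝ≥0∞) (hp : 1 ≤ p)
    (q : ℝ) (hq0 : 0 < q) (hq1 : q ≤ 1)
    (r : ℝ) (hrdef : r = -1 + 1 / p.toReal + 1 / q)
    (ρ : ℕ → ℝ) (ρmin : ℝ) (hρmin : ρmin = ⨅ j, ρ j) (hmin : 1 < ρmin)
    (hρq : Summable fun j => ((ρ j)⁻¹) ^ q)
    (β : ℝ) (hβ : β = -Real.log (1 - ρmin ^ (-q)) * ρmin ^ q)
    (C : ℝ) (hC : C = β ^ (1 / q) * Real.exp (β / q * ∑' j, ((ρ j)⁻¹) ^ q))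
    (t : MIdx → X)
    (hM : lpF p (fun μ => mpow ρ μ * ‖t μ‖) ≠ ∞)
    (habs : ∀ y : ℕ → ℝ, (∀ j, |y j| ≤ 1) →
      Summable fun μ : MIdx => ‖mpow y μ • t μ‖)
    (ybar lam : ℕ → ℝ) (hybar : ∀ j, |ybar j| ≤ 1)
    (hlam : ∀ j, 0 < lam j ∧ lam j ≤ 1 - |ybar j|)
    (s : MIdx → X)
    (hs : ∀ ν : MIdx, s ν = ∑' μ : {μ : MIdx // ν ≤ μ},
      ((mchoose μ.1 ν : ℝ) * mpow ybar (μ.1 - ν)) • t μ.1)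
    (m : ℕ) :
    ∃ Λ : Finset MIdx, Λ.card = m + 1 ∧
      ∀ y : ℕ → ℝ, (∀ j, |y j - ybar j| ≤ lam j) →
        ‖(∑' μ : MIdx, mpow y μ • t μ) -
            ∑ ν ∈ Λ, mpow (fun j => y j - ybar j) ν • s ν‖ ≤
          C * ((∏' j, (1 - |ybar j| / ρ j)⁻¹) ^ (1 - 1 / p.toReal)) *
            (lpF p fun μ => mpow ρ μ * ‖t μ‖).toReal *
            (∑' j, (((ρ j - |ybar j|) / lam j)⁻¹) ^ q) ^ (1 / q) *
            ((m : ℝ) + 1) ^ (-r) := by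
  have hx₀pos : 0 < ρmin ^ (-q) := Real.rpow_pos_of_pos (by linarith) _
  have hx₀lt : ρmin ^ (-q) < 1 := Real.rpow_lt_one_of_one_lt_of_neg hmin (by linarith)
  have hρle : ∀ j, ρmin ≤ ρ j := by
    have hbdd : BddBelow (Set.range ρ) := by
      by_contra h
      rw [hρmin, Real.iInf_of_not_bddBelow h] at hmin
      linarith
    exact fun j => hρmin ▸ ciInf_le hbdd j
  have hρ1 : ∀ j, 1 < ρ j := fun j => hmin.trans_le (hρle j)
  have hρ0 : ∀ j, 0 < ρ j := fun j => zero_lt_one.trans (hρ1 j)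
  have ha0 : ∀ j, 0 ≤ |ybar j| := fun j => abs_nonneg _
  have hdiff : ∀ j, 0 < ρ j - |ybar j| := fun j => by linarith [hρ1 j, hybar j]
  set x : ℕ → ℝ := fun j => ((ρ j - |ybar j|) / lam j)⁻¹ with hx
  have hxpos : ∀ j, 0 < x j := fun j => inv_pos.2 (div_pos (hdiff j) (hlam j).1)
  have hxρ : ∀ j, x j ≤ (ρ j)⁻¹ := fun j => by
    simp only [hx]
    rw [inv_div, ← one_div, div_le_div_iff₀ (hdiff j) (hρ0 j)]
    nlinarith [(hlam j).2, hρ1 j, ha0 j, hρ0 j]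
  have hρx₀ : ∀ j, ((ρ j)⁻¹) ^ q ≤ ρmin ^ (-q) := fun j => by
    rw [Real.rpow_neg (by linarith), ← Real.inv_rpow (by linarith)]
    exact Real.rpow_le_rpow (inv_nonneg.2 (hρ0 j).le) (inv_anti₀ (by linarith) (hρle j)) hq0.le
  have hxq : ∀ j, x j ^ q ≤ ((ρ j)⁻¹) ^ q := fun j =>
    Real.rpow_le_rpow (hxpos j).le (hxρ j) hq0.le
  have hxqpos : ∀ j, 0 < x j ^ q := fun j => Real.rpow_pos_of_pos (hxpos j) q
  have hxsum : Summable fun j => x j ^ q :=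
    Summable.of_nonneg_of_le (fun j => (hxqpos j).le) hxq hρq
  have hβ' : β = -Real.log (1 - ρmin ^ (-q)) * (ρmin ^ (-q))⁻¹ := by
    rw [hβ, Real.rpow_neg (by linarith), inv_inv]
  have hβpos : 0 < β := by
    rw [hβ']
    exact mul_pos (neg_pos.2 (Real.log_neg (by linarith) (by linarith))) (inv_pos.2 hx₀pos)
  have hXpos : 0 < ∑' j, x j ^ q := hxsum.tsum_pos (fun j => (hxqpos j).le) 0 (hxqpos 0)
  set S : ℝ := β * (∑' j, x j ^ q) * Real.exp (β * ∑' j, ((ρ j)⁻¹) ^ q) with hS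
  have hSpos : 0 < S := by positivity
  have hdsum : ∑' ν : MIdx, (if ν = 0 then 0 else ENNReal.ofReal (mpow x ν) ^ q) ≤
      ENNReal.ofReal S := by
    refine (tsum_ite_mpow_rpow_le hq0 (fun j => (hxpos j).le) (fun j => (hxq j).trans (hρx₀ j))
      hx₀pos hx₀lt hxsum hβ' hβpos.le).trans (ENNReal.ofReal_le_ofReal ?_)
    rw [hS]
    have := hxsum.tsum_le_tsum hxq hρq
    gcongr
  set A : ℝ := ∏' j, (1 - |ybar j| / ρ j)⁻¹ with hA
  have hAprod : ∀ J : Finset ℕ, ∏ j ∈ J, (1 - |ybar j| / ρ j)⁻¹ ≤ A := by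
    have hle : ∀ j, |ybar j| / ρ j ≤ (ρ j)⁻¹ := fun j => by
      rw [div_eq_mul_inv]
      exact mul_le_of_le_one_left (inv_nonneg.2 (hρ0 j).le) (hybar j)
    have hnn : ∀ j, 0 ≤ |ybar j| / ρ j := fun j => div_nonneg (ha0 j) (hρ0 j).le
    refine prod_inv_one_sub_le_tprod (c := ρmin⁻¹) (inv_lt_one_of_one_lt₀ hmin) hnn
      (fun j => (hle j).trans (inv_anti₀ (by linarith) (hρle j)))
      (Summable.of_nonneg_of_le hnn (fun j => (hle j).trans ?_) hρq)
    exact Real.self_le_rpow_of_le_one (inv_nonneg.2 (hρ0 j).le)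
      (inv_le_one_of_one_le₀ (hρ1 j).le) hq1
  have hApos : 0 < A := zero_lt_one.trans_le (by simpa using hAprod ∅)
  have hS0 : ENNReal.ofReal S ≠ 0 := (ENNReal.ofReal_pos.2 hSpos).ne'
  obtain ⟨Λ, hcard, h0, hΛ⟩ :=
    exists_finset_card_forall_notMem_le hS0 ENNReal.ofReal_ne_top hdsum 0 m
  have hne : ∀ ν : ((Λ : Set MIdx)ᶜ : Set MIdx), (ν : MIdx) ≠ 0 := fun ν hν =>
    ν.2 (by simpa [hν] using h0)
  have hmem : ∀ ν : ((Λ : Set MIdx)ᶜ : Set MIdx), (ν : MIdx) ∉ Λ := fun ν hν => ν.2 hν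
  have hkernel := tsum_tsum_kernel_le (ι := ((Λ : Set MIdx)ᶜ : Set MIdx))
    (d := fun ν => ENNReal.ofReal (mpow x ν))
    (k := fun ν μ => ENNReal.ofReal
      (binomTerm (fun j => ρ j - |ybar j|) (fun j => |ybar j|) μ ν * mpow (fun j => (ρ j)⁻¹) μ))
    (a := fun μ => mpow ρ μ * ‖t μ‖) (A := ENNReal.ofReal A) (S := ENNReal.ofReal S)
    (n := (m : ℝ≥0∞) + 1) (p := p) (q := q) hp hq0 hq1 hS0 ENNReal.ofReal_ne_top
    (fun ν => by simpa [hne ν] using hΛ ν (hmem ν))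
    (by
      refine le_trans ?_ ((ENNReal.tsum_comp_le_tsum_of_injective
        (Subtype.val_injective (p := fun ν => ν ∈ (Λ : Set MIdx)ᶜ)) _).trans hdsum)
      exact ENNReal.tsum_le_tsum fun ν => by simp [hne ν])
    (fun ν => tsum_binomTerm_div_le ha0 (fun j => sub_pos.1 (hdiff j)) hAprod ν)
    (fun μ => by
      have hb := (hasSum_binomTerm (fun j => ρ j - |ybar j|) (fun j => |ybar j|) μ).mul_right
        (mpow (fun j => (ρ j)⁻¹) μ)
      simp only [sub_add_cancel] at hb
      rw [← mpow_mul] at hb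
      have hnn : ∀ ν, 0 ≤ binomTerm (fun j => ρ j - |ybar j|) (fun j => |ybar j|) μ ν *
          mpow (fun j => (ρ j)⁻¹) μ := fun ν =>
        mul_nonneg (binomTerm_nonneg (fun j => (hdiff j).le) ha0 μ ν)
          (mpow_nonneg (fun j => inv_nonneg.2 (hρ0 j).le) μ)
      refine (ENNReal.tsum_comp_le_tsum_of_injective
        (Subtype.val_injective (p := fun ν => ν ∈ (Λ : Set MIdx)ᶜ)) fun ν => ENNReal.ofReal
          (binomTerm (fun j => ρ j - |ybar j|) (fun j => |ybar j|) μ ν *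
            mpow (fun j => (ρ j)⁻¹) μ)).trans ?_
      rw [← ENNReal.ofReal_tsum_of_nonneg hnn hb.summable, hb.tsum_eq]
      simp [mpow, Finsupp.prod, mul_inv_cancel₀ (hρ0 _).ne'])
  refine ⟨Λ, hcard, fun y hy => ?_⟩
  have hsum : Summable fun μ : MIdx => mpow (fun j => lam j + |ybar j|) μ * ‖t μ‖ := by
    have hnn : ∀ j, 0 ≤ lam j + |ybar j| := fun j => add_nonneg (hlam j).1.le (ha0 j)
    refine (habs (fun j => lam j + |ybar j|) fun j => ?_).congr fun μ => ?_
    · rw [abs_of_nonneg (hnn j)]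
      linarith [(hlam j).2]
    · rw [norm_smul, Real.norm_of_nonneg (mpow_nonneg hnn μ)]
  have hfactor : ∀ (ν μ : MIdx),
      ENNReal.ofReal (binomTerm lam (fun j => |ybar j|) μ ν * ‖t μ‖) =
      ENNReal.ofReal (mpow x ν) * ENNReal.ofReal
        (binomTerm (fun j => ρ j - |ybar j|) (fun j => |ybar j|) μ ν *
          mpow (fun j => (ρ j)⁻¹) μ) * ENNReal.ofReal (mpow ρ μ * ‖t μ‖) := fun ν μ => by
    have hl : lam = fun j => x j * (ρ j - |ybar j|) := funext fun j => by
      have := (hdiff j).ne'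
      simp only [hx, inv_div]
      field_simp
    have hinv : mpow (fun j => (ρ j)⁻¹) μ * mpow ρ μ = 1 := by
      rw [← mpow_mul]
      simp [mpow, Finsupp.prod, inv_mul_cancel₀ (hρ0 _).ne']
    have hb := binomTerm_nonneg (fun j => (hdiff j).le) ha0 μ ν
    have hi := mpow_nonneg (fun j => inv_nonneg.2 (hρ0 j).le) μ
    have hx0 := mpow_nonneg (fun j => (hxpos j).le) ν
    rw [← ENNReal.ofReal_mul hx0, ← ENNReal.ofReal_mul (mul_nonneg hx0 (mul_nonneg hb hi))]
    congr 1
    conv_lhs => rw [hl, binomTerm_mul_left, ← mul_one (mpow x ν * _), ← hinv]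
    ring
  have hmain := (enorm_tsum_sub_sum_le hsum hs hy Λ).trans
    (by simpa only [hfactor] using hkernel)
  have hn : (m : ℝ≥0∞) + 1 = ENNReal.ofReal ((m : ℝ) + 1) := by
    rw [ENNReal.ofReal_add (by positivity) zero_le_one]
    simp
  rw [hn, ← ENNReal.ofReal_toReal hM, ENNReal.ofReal_rpow_of_pos hApos,
    ENNReal.ofReal_rpow_of_pos hSpos, ENNReal.ofReal_rpow_of_pos (by positivity),
    ← ENNReal.ofReal_mul (by positivity), ← ENNReal.ofReal_mul (by positivity),
    ← ENNReal.ofReal_mul (by positivity), ← ofReal_norm,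
    ENNReal.ofReal_le_ofReal_iff (by positivity), ← hrdef] at hmain
  refine hmain.trans (le_of_eq ?_)
  rw [hS, hC, Real.mul_rpow (by positivity) (by positivity),
    Real.mul_rpow (by positivity) (by positivity), ← Real.exp_mul,
    show β * (∑' j, ((ρ j)⁻¹) ^ q) * (1 / q) = β / q * ∑' j, ((ρ j)⁻¹) ^ q by ring]
  ring
end
end
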